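/- Let K be an infinite field with char(K) = 2 and let Q be a strongly connected quiver with n vertices, d arrows (d ≥ 2) and m(Q) = m. Then D(Q,(2,…,2)) ≤ m·d, i.e., the algebra of invariants Inv(Q,(2,…,2)) has a minimal homogeneous system of generators all of whose elements have degree at most m·d. -/

import Mathlib

open Classical BigOperators

/-- A quiver (finite oriented graph data): a type of vertices, a type of arrows,
and source (tail `a''`) and target (head `a'`) maps. -/
structure QuiverData where
  V : Type
  A : Type
  src : A → V
  tgt : A → V

namespace QuiverData

variable (Q : QuiverData)

/-- `Q.IsPathFrom u v l` : the list of arrows `l` is a (possibly empty) path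
from `u` to `v`, i.e. `l = [a₁, …, a_s]` with `a₁'' = u`, `aᵢ' = a_{i+1}''`, `a_s' = v`. -/
def IsPathFrom : Q.V → Q.V → List Q.A → Prop
  | u, v, [] => u = v
  | u, v, a :: l => Q.src a = u ∧ IsPathFrom (Q.tgt a) v l

/-- A (non-empty) closed path in the vertex `v`. -/
def IsClosedAt (v : Q.V) (l : List Q.A) : Prop :=
  l ≠ [] ∧ Q.IsPathFrom v v l

/-- A (non-empty) closed path. -/
def IsClosed (l : List Q.A) : Prop := ∃ v, Q.IsClosedAt v l

/-- `deg_w(l)`: the degree of the closed path `l` in the vertex `w`,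
i.e. the number of `i` with `aᵢ' = w`. -/
noncomputable def vdeg (l : List Q.A) (w : Q.V) : ℕ :=
  Nat.card {i : Fin l.length // Q.tgt (l.get i) = w}

/-- `deg_b(l)`: the number of occurrences of the arrow `b` in the path `l`. -/
noncomputable def adeg (l : List Q.A) (b : Q.A) : ℕ :=
  Nat.card {i : Fin l.length // l.get i = b}

/-- The number of occurrences in `l` of arrows from the set `S`. -/
noncomputable def sdeg (l : List Q.A) (S : Set Q.A) : ℕ :=
  Nat.card {i : Fin l.length // l.get i ∈ S}

/-- A primitive closed path in `v`: a closed path without self-intersections,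
i.e. `deg_w = 1` for every vertex `w` of the path. -/
def IsPrimitiveAt (v : Q.V) (l : List Q.A) : Prop :=
  Q.IsClosedAt v l ∧ ∀ a ∈ l, Q.vdeg l (Q.tgt a) = 1

/-- A primitive closed path. -/
def IsPrimitive (l : List Q.A) : Prop := ∃ v, Q.IsPrimitiveAt v l

/-- `m(Q) = m` : `m` is the maximal degree of primitive closed paths in `Q`. -/
def MaxPrimDeg (m : ℕ) : Prop :=
  (∃ l, Q.IsPrimitive l ∧ l.length = m) ∧ ∀ l, Q.IsPrimitive l → l.length ≤ m

/-- `Q` is strongly connected: there is a closed path containing all vertices;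
a quiver with one vertex and no arrows is also strongly connected. -/
def StronglyConnected : Prop :=
  (∃ v l, Q.IsClosedAt v l ∧ ∀ w, ∃ a ∈ l, Q.tgt a = w) ∨
    (Subsingleton Q.V ∧ IsEmpty Q.A)

/-- Formal negation on the set (closed paths with a formal sign) ∪ {0};
`none` is the symbol `0`, and `some (e, l)` is `(-1)^e·l`. -/
def negO : Option (Bool × List Q.A) → Option (Bool × List Q.A)
  | none => none
  | some (e, l) => some (!e, l)

/-- The equivalence `≡` on the set of closed paths of `Q`, enlarged by an additional
symbol `0` (represented by `none`) and formal signs (`some (e, l)` is `(-1)^e·l`).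
The parameter `c2` is the proposition "the characteristic of the ground field is 2"
(so that the formal sign `(-1)^σ` is trivial exactly when `c2` holds).
It is the smallest equivalence, compatible with formal negation, such that for paths
`a`, `b` with `ab` a closed path and incident closed paths `a₁, a₂, …`:
(1) `ab ≡ ba`; (2) `a_{σ(1)}⋯a_{σ(t)} ≡ (-1)^σ a₁⋯a_t` for `t ≥ 2` and `σ ∈ S_t`
(generated here by transpositions of adjacent factors);
(3) `a₁²a₂ ≡ 0`; (4) if `c2` then `a₁² ≡ 0`, while if `¬c2` then `a₁a₂a₃a₄ ≡ 0`. -/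
inductive PEquiv (c2 : Prop) : Option (Bool × List Q.A) → Option (Bool × List Q.A) → Prop
  | refl (x) : PEquiv c2 x x
  | symm {x y} : PEquiv c2 x y → PEquiv c2 y x
  | trans {x y z} : PEquiv c2 x y → PEquiv c2 y z → PEquiv c2 x z
  | neg {x y} : PEquiv c2 x y → PEquiv c2 (Q.negO x) (Q.negO y)
  | cyc (u v : Q.V) (a b : List Q.A) (e : Bool) :
      Q.IsPathFrom u v a → Q.IsPathFrom v u b → a ++ b ≠ [] →
      PEquiv c2 (some (e, a ++ b)) (some (e, b ++ a))
  | swap (v : Q.V) (w₁ c d w₂ : List Q.A) (e : Bool) :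
      Q.IsPathFrom v v w₁ → Q.IsClosedAt v c → Q.IsClosedAt v d → Q.IsPathFrom v v w₂ →
      PEquiv c2 (some (e, w₁ ++ c ++ d ++ w₂))
        (some (if c2 then e else !e, w₁ ++ d ++ c ++ w₂))
  | sq_mul (v : Q.V) (c d : List Q.A) (e : Bool) :
      Q.IsClosedAt v c → Q.IsClosedAt v d →
      PEquiv c2 (some (e, c ++ c ++ d)) none
  | sq (v : Q.V) (c : List Q.A) (e : Bool) :
      c2 → Q.IsClosedAt v c → PEquiv c2 (some (e, c ++ c)) none
  | four (v : Q.V) (c₁ c₂ c₃ c₄ : List Q.A) (e : Bool) :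
      ¬c2 → Q.IsClosedAt v c₁ → Q.IsClosedAt v c₂ → Q.IsClosedAt v c₃ → Q.IsClosedAt v c₄ →
      PEquiv c2 (some (e, c₁ ++ c₂ ++ c₃ ++ c₄)) none
  | sign_triv (e : Bool) (l : List Q.A) :
      c2 → PEquiv c2 (some (e, l)) (some (!e, l))

/-- `l₁ ≡ l₂` for closed paths. -/
def PathEquiv (c2 : Prop) (l₁ l₂ : List Q.A) : Prop :=
  Q.PEquiv c2 (some (false, l₁)) (some (false, l₂))

/-- `l ≡ 0`. -/
def EquivZero (c2 : Prop) (l : List Q.A) : Prop :=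
  Q.PEquiv c2 (some (false, l)) none

/-! ### Invariants of quivers for the dimension vector `(2,…,2)` -/

/-- Variables `x_{ij}(a)` of the polynomial ring: for each arrow `a` the entries of the
`2 × 2` generic matrix `X_a`. -/
def Var : Type := Q.A × Fin 2 × Fin 2

variable (K : Type) [Field K]

/-- The substitution describing the base-change action of the group
`∏_{v} GL₂(K)` (given by a family of invertible matrices `g`) on the variables:
`x_{ij}(a)` is sent to the `(i,j)` entry of `g_{a'} X_a g_{a''}⁻¹`. -/
noncomputable def actVar (g : Q.V → Matrix (Fin 2) (Fin 2) K) (p : Q.Var) :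
    MvPolynomial Q.Var K :=
  ∑ k : Fin 2, ∑ l : Fin 2,
    MvPolynomial.C (g (Q.tgt p.1) p.2.1 k * (g (Q.src p.1))⁻¹ l p.2.2) *
      MvPolynomial.X (p.1, k, l)

/-- `f` belongs to the algebra of invariants `Inv(Q,(2,…,2))`. -/
def IsInvariant (f : MvPolynomial Q.Var K) : Prop :=
  ∀ g : Q.V → Matrix (Fin 2) (Fin 2) K, (∀ v, IsUnit (g v).det) →
    MvPolynomial.aeval (Q.actVar K g) f = f

/-- The space `Inv(Q,(2,…,2))⁺` of invariants without constant term (the span of the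
homogeneous invariants of positive degree). -/
def PlusSet : Set (MvPolynomial Q.Var K) :=
  {f | Q.IsInvariant K f ∧ MvPolynomial.constantCoeff f = 0}

/-- `f` is decomposable: it lies in the ideal `(Inv⁺)²`, i.e. in the `K`-span of
products of two invariants of positive degree. -/
def Decomposable (f : MvPolynomial Q.Var K) : Prop :=
  f ∈ Submodule.span K
    {x : MvPolynomial Q.Var K | ∃ p ∈ Q.PlusSet K, ∃ q ∈ Q.PlusSet K, x = p * q}

/-- The generic `2 × 2` matrix `X_a` of an arrow `a`. -/
noncomputable def genMat (a : Q.A) : Matrix (Fin 2) (Fin 2) (MvPolynomial Q.Var K) :=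
  Matrix.of fun i j => MvPolynomial.X (a, i, j)

/-- For a path `l = a₁⋯a_s`, the matrix product `X_{a_s} ⋯ X_{a_1}`. -/
noncomputable def pathMat (l : List Q.A) : Matrix (Fin 2) (Fin 2) (MvPolynomial Q.Var K) :=
  ((l.map (Q.genMat K)).reverse).prod

/-- `tr(X_{a_s} ⋯ X_{a_1})` for a path `l = a₁⋯a_s`. -/
noncomputable def pathTr (l : List Q.A) : MvPolynomial Q.Var K :=
  Matrix.trace (Q.pathMat K l)

/-- `det(X_{a_s} ⋯ X_{a_1})` for a path `l = a₁⋯a_s`. -/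
noncomputable def pathDet (l : List Q.A) : MvPolynomial Q.Var K :=
  Matrix.det (Q.pathMat K l)

/-- `σ_k(X_{a_s} ⋯ X_{a_1})`, the `k`-th coefficient of the characteristic polynomial
of the `2 × 2` matrix `X_{a_s} ⋯ X_{a_1}` (which vanishes for `k > 2`). -/
noncomputable def pathSigma (k : ℕ) (l : List Q.A) : MvPolynomial Q.Var K :=
  if k = 0 then 1 else if k = 1 then Q.pathTr K l
    else if k = 2 then Q.pathDet K l else 0

/-- `D(Q,(2,…,2))`: the maximal degree of an indecomposable homogeneous invariant,
i.e. the least upper bound for the degrees of elements of a minimal homogeneous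
system of generators of `Inv(Q,(2,…,2))`. -/
noncomputable def Dnum : ℕ :=
  sSup {k | ∃ f : MvPolynomial Q.Var K,
    Q.IsInvariant K f ∧ f.IsHomogeneous k ∧ ¬ Q.Decomposable K f}

end QuiverData

/-- `max {D(Q,(2,…,2)) | Q ∈ 𝒬(n,d,m)}` where `𝒬(n,d,m)` is the set of strongly
connected quivers with `n` vertices (vertex set `Fin n`), `d` arrows (arrow set `Fin d`)
and maximal degree of primitive closed paths equal to `m`. -/
noncomputable def QuiverData.maxD (K : Type) [Field K] (n d m : ℕ) : ℕ :=
  sSup {N | ∃ s t : Fin d → Fin n,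
    (QuiverData.mk (Fin n) (Fin d) s t).StronglyConnected ∧
    (QuiverData.mk (Fin n) (Fin d) s t).MaxPrimDeg m ∧
    N = (QuiverData.mk (Fin n) (Fin d) s t).Dnum K}


/-! ### Generic tools: products of matrices along lists -/

section MProd
variable {α R : Type*} [CommRing R]

noncomputable def mprod (M : α → Matrix (Fin 2) (Fin 2) R) (l : List α) :
    Matrix (Fin 2) (Fin 2) R := ((l.map M).reverse).prod

@[simp] lemma mprod_nil (M : α → Matrix (Fin 2) (Fin 2) R) : mprod M [] = 1 := by
  simp [mprod]

@[simp] lemma mprod_cons (M : α → Matrix (Fin 2) (Fin 2) R) (a : α) (l : List α) :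
    mprod M (a :: l) = mprod M l * M a := by
  simp [mprod]

lemma mprod_append (M : α → Matrix (Fin 2) (Fin 2) R) (l l' : List α) :
    mprod M (l ++ l') = mprod M l' * mprod M l := by
  simp [mprod]

end MProd

namespace QuiverData

section Paths
variable (Q : QuiverData)

@[simp] lemma isPathFrom_nil {u v : Q.V} : Q.IsPathFrom u v [] ↔ u = v := Iff.rfl

@[simp] lemma isPathFrom_cons {u v : Q.V} {a : Q.A} {l : List Q.A} :
    Q.IsPathFrom u v (a :: l) ↔ Q.src a = u ∧ Q.IsPathFrom (Q.tgt a) v l := Iff.rfl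

lemma isPathFrom_append {u w : Q.V} {l l' : List Q.A} :
    Q.IsPathFrom u w (l ++ l') ↔ ∃ v, Q.IsPathFrom u v l ∧ Q.IsPathFrom v w l' := by
  induction l generalizing u with
  | nil => simp
  | cons a l ih => simp [ih, and_assoc]

variable {Q}

lemma IsPathFrom.append {u v w : Q.V} {l l' : List Q.A} (h : Q.IsPathFrom u v l)
    (h' : Q.IsPathFrom v w l') : Q.IsPathFrom u w (l ++ l') :=
  Q.isPathFrom_append.2 ⟨v, h, h'⟩

lemma IsPathFrom.unique {u v w : Q.V} {l : List Q.A} (h : Q.IsPathFrom u v l)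
    (h' : Q.IsPathFrom u w l) : v = w := by
  induction l generalizing u with
  | nil => simp at h h'; rw [← h, ← h']
  | cons a l ih => exact ih h.2 h'.2

lemma mprod_conj {R : Type*} [CommRing R] (M M' : Q.A → Matrix (Fin 2) (Fin 2) R)
    (G Gi : Q.V → Matrix (Fin 2) (Fin 2) R) (hG : ∀ v, G v * Gi v = 1)
    (hM : ∀ a, M' a = G (Q.tgt a) * M a * Gi (Q.src a)) {u v : Q.V} {l : List Q.A}
    (h : Q.IsPathFrom u v l) : mprod M' l = G v * mprod M l * Gi u := by
  have hG' : ∀ v, Gi v * G v = 1 := fun v => mul_eq_one_comm.1 (hG v)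
  induction l generalizing u with
  | nil =>
    simp at h; subst h; simp [hG]
  | cons a l ih =>
    obtain ⟨h1, h2⟩ := h
    subst h1
    rw [mprod_cons, mprod_cons, ih h2, hM]
    have := hG' (Q.tgt a)
    calc G v * mprod M l * Gi (Q.tgt a) * (G (Q.tgt a) * M a * Gi (Q.src a))
        = G v * mprod M l * (Gi (Q.tgt a) * G (Q.tgt a)) * M a * Gi (Q.src a) := by
          simp only [Matrix.mul_assoc]
      _ = _ := by rw [this]; simp only [Matrix.mul_assoc, Matrix.mul_one]

lemma mprod_conj_trace {R : Type*} [CommRing R] (M M' : Q.A → Matrix (Fin 2) (Fin 2) R)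
    (G Gi : Q.V → Matrix (Fin 2) (Fin 2) R) (hG : ∀ v, G v * Gi v = 1)
    (hM : ∀ a, M' a = G (Q.tgt a) * M a * Gi (Q.src a)) {u : Q.V} {l : List Q.A}
    (h : Q.IsPathFrom u u l) : (mprod M' l).trace = (mprod M l).trace := by
  have hG' : ∀ v, Gi v * G v = 1 := fun v => mul_eq_one_comm.1 (hG v)
  rw [mprod_conj M M' G Gi hG hM h, Matrix.trace_mul_comm, ← Matrix.mul_assoc, hG', Matrix.one_mul]

lemma mprod_conj_det {R : Type*} [CommRing R] (M M' : Q.A → Matrix (Fin 2) (Fin 2) R)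
    (G Gi : Q.V → Matrix (Fin 2) (Fin 2) R) (hG : ∀ v, G v * Gi v = 1)
    (hM : ∀ a, M' a = G (Q.tgt a) * M a * Gi (Q.src a)) {u : Q.V} {l : List Q.A}
    (h : Q.IsPathFrom u u l) : (mprod M' l).det = (mprod M l).det := by
  rw [mprod_conj M M' G Gi hG hM h, Matrix.det_mul, Matrix.det_mul, mul_right_comm,
    ← Matrix.det_mul, hG, Matrix.det_one, one_mul]

end Paths

section Inv
variable (Q : QuiverData) (K : Type) [Field K]

lemma pathMat_eq (l : List Q.A) : Q.pathMat K l = mprod (Q.genMat K) l := rfl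

/-- ring homs and `mprod`. -/
lemma map_mprod {α R S : Type*} [CommRing R] [CommRing S] (φ : R →+* S)
    (M : α → Matrix (Fin 2) (Fin 2) R) (l : List α) :
    (mprod M l).map φ = mprod (fun a => (M a).map φ) l := by
  induction l with
  | nil => simp
  | cons a l ih => rw [mprod_cons, mprod_cons, Matrix.map_mul, ih]

lemma map_det2 {R S : Type*} [CommRing R] [CommRing S] (φ : R →+* S)
    (M : Matrix (Fin 2) (Fin 2) R) : φ M.det = (M.map φ).det := by
  simp [Matrix.det_fin_two]

lemma map_trace2 {R S : Type*} [CommRing R] [CommRing S] (φ : R →+* S)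
    (M : Matrix (Fin 2) (Fin 2) R) : φ M.trace = (M.map φ).trace := by
  simp [Matrix.trace_fin_two]

/-- the variable `x_{ij}(a)`. -/
def vr (a : Q.A) (i j : Fin 2) : Q.Var := (a, i, j)

lemma genMat_apply (a : Q.A) (i j : Fin 2) :
    Q.genMat K a i j = MvPolynomial.X (Q.vr a i j) := rfl

lemma actVar_vr (g : Q.V → Matrix (Fin 2) (Fin 2) K) (a : Q.A) (i j : Fin 2) :
    Q.actVar K g (Q.vr a i j) = ∑ k : Fin 2, ∑ l : Fin 2,
    MvPolynomial.C (g (Q.tgt a) i k * (g (Q.src a))⁻¹ l j) *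
      MvPolynomial.X (Q.vr a k l) := rfl

lemma genMat_act (g : Q.V → Matrix (Fin 2) (Fin 2) K) (a : Q.A) :
    (Q.genMat K a).map (MvPolynomial.aeval (Q.actVar K g) : _ →ₐ[K] MvPolynomial Q.Var K).toRingHom
      = (g (Q.tgt a)).map MvPolynomial.C * Q.genMat K a * ((g (Q.src a))⁻¹).map MvPolynomial.C := by
  refine Matrix.ext fun i j => ?_
  simp only [genMat_apply, Matrix.map_apply, AlgHom.toRingHom_eq_coe, RingHom.coe_coe,
    MvPolynomial.aeval_X, actVar_vr, Matrix.mul_apply, Fin.sum_univ_two, map_mul]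
  ring

lemma pathMat_conj (g : Q.V → Matrix (Fin 2) (Fin 2) K) (hg : ∀ v, IsUnit (g v).det) :
    (∀ v, (g v).map MvPolynomial.C * ((g v)⁻¹).map MvPolynomial.C
      = (1 : Matrix (Fin 2) (Fin 2) (MvPolynomial Q.Var K))) := by
  intro v
  rw [← Matrix.map_mul, Matrix.mul_nonsing_inv _ (hg v)]
  exact Matrix.map_one _ (map_zero _) (map_one _)

lemma pathTr_inv {v : Q.V} {l : List Q.A} (h : Q.IsPathFrom v v l) :
    Q.IsInvariant K (Q.pathTr K l) := by
  intro g hg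
  rw [pathTr, pathMat_eq]
  have := map_trace2 (MvPolynomial.aeval (Q.actVar K g) : _ →ₐ[K] MvPolynomial Q.Var K).toRingHom
    (mprod (Q.genMat K) l)
  rw [map_mprod] at this
  refine Eq.trans this ?_
  exact mprod_conj_trace _ _ _ _ (pathMat_conj Q K g hg) (genMat_act Q K g) h

lemma pathDet_inv {v : Q.V} {l : List Q.A} (h : Q.IsPathFrom v v l) :
    Q.IsInvariant K (Q.pathDet K l) := by
  intro g hg
  rw [pathDet, pathMat_eq]
  have := map_det2 (MvPolynomial.aeval (Q.actVar K g) : _ →ₐ[K] MvPolynomial Q.Var K).toRingHom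
    (mprod (Q.genMat K) l)
  rw [map_mprod] at this
  refine Eq.trans this ?_
  exact mprod_conj_det _ _ _ _ (pathMat_conj Q K g hg) (genMat_act Q K g) h

lemma pathMat_hom (l : List Q.A) (i j : Fin 2) :
    (Q.pathMat K l i j).IsHomogeneous l.length := by
  rw [pathMat_eq]
  induction l generalizing i j with
  | nil =>
    rw [mprod_nil, Matrix.one_apply]
    split_ifs
    · exact MvPolynomial.isHomogeneous_one _ _
    · exact MvPolynomial.isHomogeneous_zero _ _ _
  | cons a l ih =>
    rw [mprod_cons, Matrix.mul_apply]
    refine MvPolynomial.IsHomogeneous.sum _ _ _ fun k _ => ?_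
    exact (ih i k).mul (MvPolynomial.isHomogeneous_X _ _)

lemma pathTr_hom (l : List Q.A) : (Q.pathTr K l).IsHomogeneous l.length := by
  rw [pathTr, Matrix.trace_fin_two]
  exact (pathMat_hom Q K l _ _).add (pathMat_hom Q K l _ _)

lemma pathDet_hom (l : List Q.A) : (Q.pathDet K l).IsHomogeneous (2 * l.length) := by
  rw [pathDet, Matrix.det_fin_two, two_mul]
  exact ((pathMat_hom Q K l _ _).mul (pathMat_hom Q K l _ _)).sub
    ((pathMat_hom Q K l _ _).mul (pathMat_hom Q K l _ _))

lemma const_zero_of_hom {σ : Type*} {f : MvPolynomial σ K} {n : ℕ} (h : f.IsHomogeneous n)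
    (hn : n ≠ 0) : MvPolynomial.constantCoeff f = 0 := by
  rw [MvPolynomial.constantCoeff_eq]
  exact h.coeff_eq_zero (by simpa using hn.symm)

lemma pathTr_plus {v : Q.V} {l : List Q.A} (h : Q.IsPathFrom v v l) (hl : l ≠ []) :
    Q.pathTr K l ∈ Q.PlusSet K :=
  ⟨pathTr_inv Q K h, const_zero_of_hom K (pathTr_hom Q K l) (by simpa using hl)⟩

lemma pathDet_plus {v : Q.V} {l : List Q.A} (h : Q.IsPathFrom v v l) (hl : l ≠ []) :
    Q.pathDet K l ∈ Q.PlusSet K :=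
  ⟨pathDet_inv Q K h, const_zero_of_hom K (pathDet_hom Q K l) (by simpa using hl)⟩

lemma isInvariant_mul {f g : MvPolynomial Q.Var K} (hf : Q.IsInvariant K f)
    (hg : Q.IsInvariant K g) : Q.IsInvariant K (f * g) := by
  intro G hG; rw [map_mul, hf G hG, hg G hG]

lemma plus_mul {f g : MvPolynomial Q.Var K} (hf : f ∈ Q.PlusSet K)
    (hg : g ∈ Q.PlusSet K) : f * g ∈ Q.PlusSet K :=
  ⟨isInvariant_mul Q K hf.1 hg.1, by rw [map_mul, hf.2, zero_mul]⟩

noncomputable def Dec : Submodule K (MvPolynomial Q.Var K) :=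
  Submodule.span K
    {x : MvPolynomial Q.Var K | ∃ p ∈ Q.PlusSet K, ∃ q ∈ Q.PlusSet K, x = p * q}

lemma dec_mul {f g : MvPolynomial Q.Var K} (hf : f ∈ Q.PlusSet K)
    (hg : g ∈ Q.PlusSet K) : f * g ∈ Dec Q K :=
  Submodule.subset_span ⟨f, hf, g, hg, rfl⟩

end Inv
end QuiverData


namespace QuiverData

section Phase3
variable (Q : QuiverData) (K : Type) [Field K]

lemma tr3_identity {R : Type*} [CommRing R] (A B C : Matrix (Fin 2) (Fin 2) R) :
    (A * B * C).trace + (B * A * C).trace = A.trace * (B * C).trace + B.trace * (A * C).trace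
      + C.trace * (A * B).trace - A.trace * B.trace * C.trace := by
  simp only [Matrix.trace_fin_two, Matrix.mul_apply, Fin.sum_univ_two]
  ring

lemma tr_sq_identity {R : Type*} [CommRing R] (A B : Matrix (Fin 2) (Fin 2) R) :
    (B * (A * A)).trace = A.trace * (B * A).trace - A.det * B.trace := by
  simp only [Matrix.trace_fin_two, Matrix.mul_apply, Fin.sum_univ_two, Matrix.det_fin_two]
  ring

lemma pathTr_rot (l l' : List Q.A) : Q.pathTr K (l ++ l') = Q.pathTr K (l' ++ l) := by
  simp only [pathTr, pathMat_eq, mprod_append]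
  exact Matrix.trace_mul_comm _ _

def ZZ (l : List Q.A) : Prop := Q.pathTr K l ∈ Dec Q K

lemma ZZ_rot (l l' : List Q.A) : Q.ZZ K (l ++ l') ↔ Q.ZZ K (l' ++ l) := by
  rw [ZZ, pathTr_rot]; rfl

lemma ZZ_swap [CharP K 2] {v : Q.V} {A B C : List Q.A} (hA : Q.IsPathFrom v v A)
    (hB : Q.IsPathFrom v v B) (hC : Q.IsPathFrom v v C) :
    Q.ZZ K (A ++ B ++ C) ↔ Q.ZZ K (B ++ A ++ C) := by
  by_cases hA0 : A = []
  · subst hA0; simp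
  by_cases hB0 : B = []
  · subst hB0; simp
  by_cases hC0 : C = []
  · subst hC0; simpa using Q.ZZ_rot K A B
  have key : Q.pathTr K (A ++ B ++ C) + Q.pathTr K (B ++ A ++ C) ∈ Dec Q K := by
    have h1 := tr3_identity (mprod (Q.genMat K) A) (mprod (Q.genMat K) B) (mprod (Q.genMat K) C)
    have e : Q.pathTr K (A ++ B ++ C) + Q.pathTr K (B ++ A ++ C) =
        Q.pathTr K A * Q.pathTr K (C ++ B) + Q.pathTr K B * Q.pathTr K (C ++ A)
        + Q.pathTr K C * Q.pathTr K (B ++ A) - Q.pathTr K A * Q.pathTr K B * Q.pathTr K C := by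
      simp only [pathTr, pathMat_eq, mprod_append]
      rw [← h1, Matrix.trace_mul_comm, Matrix.trace_mul_comm (mprod (Q.genMat K) C), add_comm]
    rw [e]
    refine Submodule.sub_mem _ (Submodule.add_mem _ (Submodule.add_mem _ ?_ ?_) ?_) ?_
    · exact dec_mul Q K (pathTr_plus Q K hA hA0) (pathTr_plus Q K (hC.append hB) (by simp [hC0]))
    · exact dec_mul Q K (pathTr_plus Q K hB hB0) (pathTr_plus Q K (hC.append hA) (by simp [hC0]))
    · exact dec_mul Q K (pathTr_plus Q K hC hC0) (pathTr_plus Q K (hB.append hA) (by simp [hB0]))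
    · exact dec_mul Q K (plus_mul Q K (pathTr_plus Q K hA hA0) (pathTr_plus Q K hB hB0))
        (pathTr_plus Q K hC hC0)
  constructor
  · intro h
    have := Submodule.sub_mem _ key h
    rwa [add_sub_cancel_left] at this
  · intro h
    have := Submodule.sub_mem _ key h
    rwa [add_sub_cancel_right] at this

lemma ZZ_sq [CharP K 2] {v : Q.V} {c w : List Q.A} (hc : Q.IsPathFrom v v c) (hc0 : c ≠ [])
    (hw : Q.IsPathFrom v v w) : Q.ZZ K (c ++ c ++ w) := by
  have h := tr_sq_identity (mprod (Q.genMat K) c) (mprod (Q.genMat K) w)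
  have e : Q.pathTr K (c ++ c ++ w) = Q.pathTr K c * Q.pathTr K (c ++ w)
      - Q.pathDet K c * Q.pathTr K w := by
    simp only [pathTr, pathDet, pathMat_eq, mprod_append]
    rw [← h]
  rw [ZZ, e]
  refine Submodule.sub_mem _ ?_ ?_
  · exact dec_mul Q K (pathTr_plus Q K hc hc0) (pathTr_plus Q K (hc.append hw) (by simp [hc0]))
  · by_cases hw0 : w = []
    · subst hw0
      have : Q.pathTr K [] = 0 := by
        simp only [pathTr, pathMat_eq, mprod_nil, Matrix.trace_one, Fintype.card_fin]
        exact CharP.cast_eq_zero _ 2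
      rw [this, mul_zero]; exact Submodule.zero_mem _
    · exact dec_mul Q K (pathDet_plus Q K hc hc0) (pathTr_plus Q K hw hw0)

lemma two_count {α : Type*} {b : α} {y : List α} (h : 2 ≤ y.count b) :
    ∃ y1 y2 y3, y = y1 ++ b :: y2 ++ b :: y3 := by
  have h1 : b ∈ y := List.count_pos_iff.1 (by omega)
  obtain ⟨s, t, rfl⟩ := List.append_of_mem h1
  have : (s ++ t).count b ≥ 1 := by
    simp [List.count_append, List.count_cons] at h ⊢; omega
  have h2 : b ∈ s ++ t := List.count_pos_iff.1 this
  rcases List.mem_append.1 h2 with h2 | h2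
  · obtain ⟨s1, s2, rfl⟩ := List.append_of_mem h2
    exact ⟨s1, s2, t, by simp⟩
  · obtain ⟨s1, s2, rfl⟩ := List.append_of_mem h2
    exact ⟨s, s1, s2, by simp⟩

variable {Q}

lemma ext1 [CharP K 2] {v : Q.V} (c' : List Q.A) : ∀ (u w : Q.V) (P y : List Q.A),
    Q.IsPathFrom v u P → Q.IsPathFrom u v y → Q.IsPathFrom u w c' → c'.Nodup →
    (∀ b ∈ c', 2 ≤ y.count b) →
    ∃ y', Q.IsPathFrom w v y' ∧ y.Perm (c' ++ y') ∧ (Q.ZZ K (P ++ y) ↔ Q.ZZ K (P ++ c' ++ y')) := by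
  induction c' with
  | nil =>
    intro u w P y hP hy hc _ _
    simp at hc; subst hc
    exact ⟨y, hy, by simp, by simp⟩
  | cons b c' ih =>
    intro u w P y hP hy hc hnd hcount
    obtain ⟨y1, y2, y3, rfl⟩ := two_count (hcount b (by simp))
    obtain ⟨hsb, hc'⟩ := hc
    have hy' := hy
    rw [isPathFrom_append, ] at hy'
    obtain ⟨z, hz1, hz2, hz3⟩ := hy'
    rw [isPathFrom_append] at hz1
    obtain ⟨z', hz4, hz5, hz6⟩ := hz1
    have e1 : z = u := by rw [← hz2, hsb]
    have e2 : z' = u := by rw [← hz5, hsb]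
    subst e1; subst e2
    have hby2 : Q.IsPathFrom z' z' (b :: y2) := ⟨hz5, hz6⟩
    have hby3 : Q.IsPathFrom z' v (b :: y3) := ⟨hz2, hz3⟩
    have step : Q.ZZ K (P ++ (y1 ++ b :: y2 ++ b :: y3)) ↔
        Q.ZZ K ((P ++ [b]) ++ (y2 ++ y1 ++ b :: y3)) := by
      rw [ZZ_rot]
      have h1 := Q.ZZ_swap K hz4 hby2 (hby3.append hP)
      have h2 := Q.ZZ_rot K P ((b :: y2) ++ y1 ++ b :: y3)
      simp only [List.append_assoc, List.cons_append, List.nil_append] at h1 h2 ⊢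
      rw [h1, h2]
    have hnd' := List.nodup_cons.1 hnd
    obtain ⟨y', p1, p2, p3⟩ := ih (Q.tgt b) w (P ++ [b]) (y2 ++ y1 ++ b :: y3)
      (hP.append ⟨hsb, rfl⟩) ((hz6.append hz4).append hby3) hc' hnd'.2 (by
        intro b' hb'
        have := hcount b' (by simp [hb'])
        have hne : b' ≠ b := by rintro rfl; exact hnd'.1 hb'
        simp [List.count_append, List.count_cons, hne.symm] at this ⊢
        omega)
    refine ⟨y', p1, ?_, ?_⟩
    · refine List.Perm.trans ?_ (List.Perm.cons b p2)
      rw [List.perm_iff_count]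
      intro x
      simp [List.count_append, List.count_cons]
      omega
    · rw [step, p3]; simp

lemma ext2 [CharP K 2] {v : Q.V} {a1 : Q.A} {c' P y : List Q.A}
    (hP : Q.IsPathFrom v v P) (hy : Q.IsPathFrom v v y) (hc : Q.IsPathFrom v v (a1 :: c'))
    (hnd : (a1 :: c').Nodup) (h1 : a1 ∈ y) (h2 : ∀ b ∈ c', 2 ≤ y.count b) :
    ∃ y', Q.IsPathFrom v v y' ∧ y.Perm ((a1 :: c') ++ y') ∧
      (Q.ZZ K (P ++ y) ↔ Q.ZZ K (P ++ (a1 :: c') ++ y')) := by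
  obtain ⟨y0, y1, rfl⟩ := List.append_of_mem h1
  have hy' := hy
  rw [isPathFrom_append] at hy'
  obtain ⟨z, hz1, hz2, hz3⟩ := hy'
  obtain ⟨hs, hc'⟩ := hc
  have : z = v := by rw [← hz2, hs]
  subst this
  have hnd' := List.nodup_cons.1 hnd
  obtain ⟨y', p1, p2, p3⟩ := ext1 K c' (Q.tgt a1) z (P ++ [a1]) (y1 ++ y0)
    (hP.append ⟨hs, rfl⟩) (hz3.append hz1) hc' hnd'.2 (by
      intro b' hb'
      have := h2 b' hb'
      have hne : b' ≠ a1 := by rintro rfl; exact hnd'.1 hb'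
      simp [List.count_append, List.count_cons, hne.symm] at this ⊢
      omega)
  refine ⟨y', p1, ?_, ?_⟩
  · refine List.Perm.trans ?_ (List.Perm.cons a1 p2)
    rw [List.perm_iff_count]
    intro x
    simp [List.count_append, List.count_cons]
    omega
  · have hay : Q.IsPathFrom z z (a1 :: y1) := ⟨hs, hz3⟩
    have h3 := Q.ZZ_swap K hz1 hay hP
    have h4 := Q.ZZ_rot K P (y0 ++ a1 :: y1)
    have h5 := Q.ZZ_rot K P ((a1 :: y1) ++ y0)
    simp only [List.append_assoc, List.cons_append, List.nil_append] at h3 h4 h5 p3 ⊢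
    rw [h4, h3, ← h5, p3]

/-- the key vanishing criterion. -/
lemma ZZ_of_cycle [CharP K 2] {u v : Q.V} {a1 : Q.A} {c' l : List Q.A}
    (hl : Q.IsPathFrom u u l) (hc : Q.IsPathFrom v v (a1 :: c'))
    (hnd : (a1 :: c').Nodup) (h1 : 2 ≤ l.count a1) (h2 : ∀ b ∈ c', 3 ≤ l.count b) :
    Q.ZZ K l := by
  have ha : a1 ∈ l := List.count_pos_iff.1 (by omega)
  obtain ⟨l0, l1, rfl⟩ := List.append_of_mem ha
  have hl' := hl
  rw [isPathFrom_append] at hl'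
  obtain ⟨z, hz1, hz2, hz3⟩ := hl'
  have : z = v := by rw [← hz2, hc.1]
  subst this
  rw [ZZ_rot]
  have hy : Q.IsPathFrom z z (a1 :: l1 ++ l0) := IsPathFrom.append ⟨hz2, hz3⟩ hz1
  have hcount : ∀ b, (l0 ++ a1 :: l1).count b = (a1 :: l1 ++ l0).count b := by
    intro b; simp [List.count_append, List.count_cons]; omega
  simp only [hcount] at h1 h2
  generalize a1 :: l1 ++ l0 = y at *
  obtain ⟨y', p1, p2, p3⟩ := ext2 K (P := []) rfl hy hc hnd (List.count_pos_iff.1 (by omega))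
    (fun b hb => by have := h2 b hb; omega)
  have hcy : ∀ b ∈ a1 :: c', y.count b = 1 + y'.count b := by
    intro b hb
    rw [List.perm_iff_count.1 p2 b, List.count_append, List.count_eq_one_of_mem hnd hb]
  obtain ⟨y'', q1, q2, q3⟩ := ext2 K (P := a1 :: c') hc p1 hc hnd
    (List.count_pos_iff.1 (by have := hcy a1 (by simp); omega))
    (fun b hb => by have := h2 b hb; have := hcy b (by simp [hb]); omega)
  simp only [List.nil_append] at p3
  rw [p3, q3]
  exact ZZ_sq Q K hc (by simp) q1

end Phase3
end QuiverData


namespace QuiverData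

section Phase3b
variable {Q : QuiverData} (K : Type) [Field K]

lemma isPrimitive_of_nodup {v : Q.V} {l : List Q.A} (hl : Q.IsClosedAt v l)
    (hn : (l.map Q.tgt).Nodup) : Q.IsPrimitive l := by
  refine ⟨v, hl, fun a ha => ?_⟩
  rw [vdeg, Nat.card_eq_one_iff_unique]
  obtain ⟨i, hi⟩ := List.mem_iff_get.1 ha
  refine ⟨⟨?_⟩, ⟨i, by rw [hi]⟩⟩
  rintro ⟨i1, h1⟩ ⟨i2, h2⟩
  have h3 : Q.tgt (l.get i1) = Q.tgt (l.get i2) := h1.trans h2.symm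
  have := List.nodup_iff_injective_get.1 hn
  have h4 := @this ⟨i1, by simp⟩ ⟨i2, by simp⟩ (by simpa using h3)
  simp at h4
  exact Subtype.ext (Fin.ext h4)

lemma split_nonprim {v : Q.V} {l : List Q.A} (hl : Q.IsClosedAt v l)
    (hn : ¬ (l.map Q.tgt).Nodup) : ∃ w p q r, l = p ++ q ++ r ∧ q ≠ [] ∧ p ++ r ≠ [] ∧
      Q.IsPathFrom w w q ∧ Q.IsPathFrom v w p ∧ Q.IsPathFrom w v r := by
  rw [List.nodup_iff_count_le_one] at hn
  push Not at hn
  obtain ⟨w, hw⟩ := hn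
  obtain ⟨y1, y2, y3, hy⟩ := two_count (show 2 ≤ _ from hw)
  obtain ⟨l', l3', rfl, h1, h2⟩ := List.map_eq_append_iff.1 hy
  obtain ⟨l1, l2', rfl, h3, h4⟩ := List.map_eq_append_iff.1 h1
  obtain ⟨b, l3, rfl, hb, h5⟩ := List.map_eq_cons_iff.1 h2
  obtain ⟨a, l2, rfl, ha, h6⟩ := List.map_eq_cons_iff.1 h4
  have hp := hl.2
  rw [isPathFrom_append, ] at hp
  obtain ⟨z, hz1, hz2, hz3⟩ := hp
  rw [isPathFrom_append] at hz1
  obtain ⟨z', hz4, hz5, hz6⟩ := hz1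
  refine ⟨w, l1 ++ [a], l2 ++ [b], l3, by simp, by simp, by simp, ?_, ?_, ?_⟩
  · rw [← ha]; refine hz6.append ⟨hz2, ?_⟩; rw [ha]; exact hb
  · exact hz4.append ⟨hz5, ha⟩
  · rw [← hb]; exact hz3

lemma prim_decomp (n : ℕ) : ∀ (v : Q.V) (l : List Q.A), l.length ≤ n → Q.IsPathFrom v v l →
    ∃ cs : List (List Q.A), (∀ c ∈ cs, (∃ w, Q.IsClosedAt w c) ∧ (c.map Q.tgt).Nodup) ∧
      l.Perm cs.flatten := by
  induction n with
  | zero =>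
    intro v l hl _
    have : l = [] := List.length_eq_zero_iff.1 (by omega)
    subst this
    exact ⟨[], by simp, by simp⟩
  | succ n ih =>
    intro v l hl hp
    by_cases h0 : l = []
    · subst h0; exact ⟨[], by simp, by simp⟩
    by_cases hn : (l.map Q.tgt).Nodup
    · exact ⟨[l], by simpa using ⟨⟨v, h0, hp⟩, hn⟩, by simp⟩
    obtain ⟨w, p, q, r, rfl, hq, hpr, h1, h2, h3⟩ := split_nonprim ⟨h0, hp⟩ hn
    have hq' := List.length_pos_iff.2 hq
    have hpr' := List.length_pos_iff.2 hpr
    simp at hl hpr'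
    obtain ⟨cs1, a1, b1⟩ := ih w q (by omega) h1
    obtain ⟨cs2, a2, b2⟩ := ih v (p ++ r) (by simp; omega) (h2.append h3)
    refine ⟨cs1 ++ cs2, ?_, ?_⟩
    · intro c hc
      rcases List.mem_append.1 hc with hc | hc
      · exact a1 c hc
      · exact a2 c hc
    · rw [List.flatten_append]
      refine List.Perm.trans ?_ (b1.append b2)
      rw [List.perm_iff_count]; intro x; simp [List.count_append]; omega

lemma det_dec {v : Q.V} {l : List Q.A} {m : ℕ} (hm : Q.MaxPrimDeg m) (hl : Q.IsClosedAt v l)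
    (h : m < l.length) : Q.pathDet K l ∈ Dec Q K := by
  have hn : ¬ (l.map Q.tgt).Nodup := fun hn => by
    have := hm.2 l (isPrimitive_of_nodup hl hn); omega
  obtain ⟨w, p, q, r, rfl, hq, hpr, h1, h2, h3⟩ := split_nonprim hl hn
  have : Q.pathDet K (p ++ q ++ r) = Q.pathDet K q * Q.pathDet K (p ++ r) := by
    simp only [pathDet, pathMat_eq, mprod_append, Matrix.det_mul]; ring
  rw [this]
  exact dec_mul Q K (pathDet_plus Q K h1 hq) (pathDet_plus Q K (h2.append h3) hpr)

lemma tr_dec [CharP K 2] [Fintype Q.A] {v : Q.V} {l : List Q.A} {m : ℕ} (hm : Q.MaxPrimDeg m)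
    (hl : Q.IsClosedAt v l) (h : m * Fintype.card Q.A < l.length) : Q.ZZ K l := by
  by_contra hZ
  obtain ⟨cs, hcs, hperm⟩ := prim_decomp l.length v l le_rfl hl.2
  set φ : Q.A → ℕ := fun a => if l.count a = 1 then 2 else if l.count a = 2 then 1 else 0 with hφ
  have hcyc : ∀ c ∈ cs, 2 ≤ (c.map φ).sum := by
    intro c hc
    by_contra hlt
    push Not at hlt
    obtain ⟨⟨w, hw0, hw⟩, hnd⟩ := hcs c hc
    have hsub : ∀ b ∈ c, 1 ≤ l.count b := by
      intro b hb
      have : b ∈ l := hperm.mem_iff.2 (List.mem_flatten.2 ⟨c, hc, hb⟩)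
      exact List.count_pos_iff.2 this
    have : ∃ s a t, c = s ++ a :: t ∧ ((s ++ t).map φ).sum = 0 := by
      by_cases h0 : (c.map φ).sum = 0
      · obtain ⟨a, t, rfl⟩ := List.exists_cons_of_ne_nil hw0
        refine ⟨[], a, t, rfl, ?_⟩
        simp at h0 ⊢
        exact h0.2
      · have : ∃ a ∈ c, φ a ≠ 0 := by
          by_contra hh
          push Not at hh
          exact h0 (by simpa [List.sum_eq_zero_iff] using hh)
        obtain ⟨a, ha, hpa⟩ := this
        obtain ⟨s, t, rfl⟩ := List.append_of_mem ha
        refine ⟨s, a, t, rfl, ?_⟩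
        simp only [List.map_append, List.map_cons, List.sum_append, List.sum_cons] at hlt ⊢
        omega
    obtain ⟨s, a, t, rfl, hst⟩ := this
    rw [isPathFrom_append] at hw
    obtain ⟨z, hz1, hz2, hz3⟩ := hw
    apply hZ
    have hnd2 : (s ++ a :: t).Nodup := List.Nodup.of_map _ hnd
    have hpa : φ a ≤ 1 := by
      simp only [List.map_append, List.map_cons, List.sum_append, List.sum_cons] at hlt
      omega
    refine ZZ_of_cycle K (c' := t ++ s) (a1 := a) (v := z) hl.2 ⟨hz2, hz3.append hz1⟩ ?_ ?_ ?_
    · have : (a :: (t ++ s)).Perm (s ++ a :: t) := by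
        rw [List.perm_iff_count]; intro x; simp [List.count_append, List.count_cons]; omega
      exact this.nodup_iff.2 hnd2
    · have h1 := hsub a (by simp)
      simp only [hφ] at hpa
      split_ifs at hpa <;> omega
    · intro b hb
      have hb' : φ b = 0 := by
        rw [List.sum_eq_zero_iff] at hst
        exact hst _ (List.mem_map_of_mem (by simpa [or_comm] using hb))
      have h1 := hsub b (by simp at hb ⊢; tauto)
      simp only [hφ] at hb'
      split_ifs at hb'; omega
  have h1 : (l.map φ).sum = (cs.map fun c => (c.map φ).sum).sum := by
    rw [(hperm.map φ).sum_eq, List.map_flatten, List.sum_flatten, List.map_map]; rfl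
  have h2 : (l.map φ).sum ≤ 2 * Fintype.card Q.A := by
    rw [Finset.sum_list_map_count]
    calc ∑ a ∈ l.toFinset, l.count a • φ a ≤ ∑ a ∈ l.toFinset, 2 := by
          refine Finset.sum_le_sum fun a _ => ?_
          simp only [hφ, smul_eq_mul]
          split_ifs with h1 h2
          · omega
          · omega
          · simp
      _ ≤ _ := by
          rw [Finset.sum_const, smul_eq_mul, mul_comm]
          exact Nat.mul_le_mul_left _ (Finset.card_le_univ _)
  have h3 : 2 * cs.length ≤ (cs.map fun c => (c.map φ).sum).sum := by
    have := List.card_nsmul_le_sum (cs.map fun c => (c.map φ).sum) 2 (by simpa using hcyc)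
    simpa [mul_comm] using this
  have h4 : l.length ≤ cs.length * m := by
    rw [hperm.length_eq, List.length_flatten]
    have := List.sum_le_card_nsmul (cs.map List.length) m (by
      intro x hx
      obtain ⟨c, hc, rfl⟩ := List.mem_map.1 hx
      obtain ⟨⟨w, hw⟩, hnd⟩ := hcs c hc
      exact hm.2 c (isPrimitive_of_nodup hw hnd))
    simpa using this
  have h5 : cs.length ≤ Fintype.card Q.A := by omega
  have := Nat.mul_le_mul_right m h5
  rw [mul_comm m] at h
  omega

/-- degree `k` elements of the trace algebra: spans of monomials. -/
def gens (Q : QuiverData) (K : Type) [Field K] : Set (MvPolynomial Q.Var K) :=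
  {f | ∃ l, Q.IsClosed l ∧ (f = Q.pathTr K l ∨ f = Q.pathDet K l)}

lemma gens_plus {f : MvPolynomial Q.Var K} (hf : f ∈ gens Q K) : f ∈ Q.PlusSet K := by
  obtain ⟨l, ⟨v, h0, h1⟩, rfl | rfl⟩ := hf
  · exact pathTr_plus Q K h1 h0
  · exact pathDet_plus Q K h1 h0

lemma closure_cases {f : MvPolynomial Q.Var K} (hf : f ∈ Submonoid.closure (gens Q K)) :
    (f = 1 ∨ f ∈ gens Q K ∨ (f ∈ Dec Q K ∧ f ∈ Q.PlusSet K)) ∧ ∃ n, f.IsHomogeneous n := by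
  induction hf using Submonoid.closure_induction with
  | mem f hf =>
    refine ⟨Or.inr (Or.inl hf), ?_⟩
    obtain ⟨l, -, rfl | rfl⟩ := hf
    · exact ⟨_, pathTr_hom Q K l⟩
    · exact ⟨_, pathDet_hom Q K l⟩
  | one => exact ⟨Or.inl rfl, 0, MvPolynomial.isHomogeneous_one _ _⟩
  | mul f g _ _ hf hg =>
    obtain ⟨hf, n, hn⟩ := hf
    obtain ⟨hg, n', hn'⟩ := hg
    refine ⟨?_, n + n', hn.mul hn'⟩
    by_cases hf1 : f = 1
    · rw [hf1, one_mul]; exact hg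
    by_cases hg1 : g = 1
    · rw [hg1, mul_one]; exact hf
    have hf' : f ∈ Q.PlusSet K := by
      rcases hf with hf | hf | hf
      · exact absurd hf hf1
      · exact gens_plus K hf
      · exact hf.2
    have hg' : g ∈ Q.PlusSet K := by
      rcases hg with hg | hg | hg
      · exact absurd hg hg1
      · exact gens_plus K hg
      · exact hg.2
    exact Or.inr (Or.inr ⟨dec_mul Q K hf' hg', plus_mul Q K hf' hg'⟩)

theorem phase3 [CharP K 2] [Fintype Q.A] {m : ℕ} (hm : Q.MaxPrimDeg m)
    (hd2 : 2 ≤ Fintype.card Q.A) {f : MvPolynomial Q.Var K} {k : ℕ}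
    (hf : f ∈ Algebra.adjoin K (gens Q K)) (hk : f.IsHomogeneous k)
    (hlt : m * Fintype.card Q.A < k) : f ∈ Dec Q K := by
  have h1 : f ∈ Submodule.span K (Submonoid.closure (gens Q K) : Set (MvPolynomial Q.Var K)) := by
    rw [← Algebra.adjoin_eq_span]; exact hf
  have key : ∀ g ∈ Submodule.span K (Submonoid.closure (gens Q K) : Set (MvPolynomial Q.Var K)),
      MvPolynomial.homogeneousComponent k g ∈ Dec Q K := by
    intro g hg
    induction hg using Submodule.span_induction with
    | zero => rw [map_zero]; exact Submodule.zero_mem _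
    | add x y _ _ hx hy => rw [map_add]; exact Submodule.add_mem _ hx hy
    | smul c x _ hx => rw [map_smul]; exact Submodule.smul_mem _ _ hx
    | mem x hx =>
      obtain ⟨hx1, n, hn⟩ := closure_cases K hx
      rw [MvPolynomial.homogeneousComponent_of_mem hn]
      split_ifs with hkn
      · subst hkn
        by_cases hx0 : x = 0
        · rw [hx0]; exact Submodule.zero_mem _
        rcases hx1 with rfl | hx1 | hx1
        · have := hn.inj_right (MvPolynomial.isHomogeneous_one _ _) hx0
          omega
        · obtain ⟨l, ⟨v, hl⟩, rfl | rfl⟩ := hx1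
          · have := hn.inj_right (pathTr_hom Q K l) hx0
            exact tr_dec K hm hl (by omega)
          · have := hn.inj_right (pathDet_hom Q K l) hx0
            refine det_dec K hm hl ?_
            have h6 := Nat.mul_le_mul_left m hd2
            omega
        · exact hx1.1
      · exact Submodule.zero_mem _
  have := key f h1
  rwa [MvPolynomial.homogeneousComponent_of_mem hk, if_pos rfl] at this

end Phase3b
end QuiverData


/-! ### Phase 2: double quiver words -/

section Bools

/-- number of sign changes in a list -/
def lt : List Bool → ℕ
  | [] => 0
  | [_] => 0
  | x :: y :: l => (if x = y then 0 else 1) + lt (y :: l)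

def ct : List Bool → ℕ
  | [] => 0
  | b :: l => lt (b :: l ++ [b])

lemma lt_append (A B : List Bool) (x : Bool) : lt (A ++ x :: B) = lt (A ++ [x]) + lt (x :: B) := by
  induction A with
  | nil => simp [lt]
  | cons a A ih =>
    cases A with
    | nil => simp [lt]
    | cons a' A => simp only [List.cons_append, lt] at ih ⊢; rw [ih]; omega

lemma ct_rot (A B : List Bool) : ct (A ++ B) = ct (B ++ A) := by
  cases A with
  | nil => simp
  | cons a A =>
    cases B with
    | nil => simp
    | cons b B =>
      have h1 := lt_append (a :: A) (B ++ [a]) b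
      have h2 := lt_append (b :: B) (A ++ [b]) a
      simp only [ct, List.cons_append, List.append_assoc] at h1 h2 ⊢
      rw [h1, h2]; omega

lemma lt_concat2 (A : List Bool) (x y : Bool) :
    lt (A ++ [x, y]) = lt (A ++ [x]) + (if x = y then 0 else 1) := by
  rw [lt_append]; simp [lt]

/-- `Ends x y A`: `A` starts with `x` and ends with `y`. -/
def Ends {α : Type*} (x y : α) (A : List α) : Prop := (∃ B, A = x :: B) ∧ (∃ B, A = B ++ [y])

lemma lt_join {A B : List Bool} {a b c d : Bool} (hA : Ends a b A) (hB : Ends c d B) :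
    lt (A ++ B) = lt A + (if b = c then 0 else 1) + lt B := by
  obtain ⟨A', rfl⟩ := hA.2
  obtain ⟨B', rfl⟩ := hB.1
  have := lt_append (A' ++ [b]) B' c
  rw [this]
  simp only [List.append_assoc, List.cons_append, List.nil_append]
  rw [lt_concat2]

lemma Ends.join {α : Type*} {A B : List α} {a b c d : α} (hA : Ends a b A) (hB : Ends c d B) :
    Ends a d (A ++ B) := by
  obtain ⟨⟨A', rfl⟩, _⟩ := hA
  obtain ⟨_, ⟨B', rfl⟩⟩ := hB
  exact ⟨⟨_, rfl⟩, ⟨a :: A' ++ B', by simp⟩⟩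

lemma ct_of_ends {A : List Bool} {a b : Bool} (hA : Ends a b A) :
    ct A = lt A + (if b = a then 0 else 1) := by
  obtain ⟨⟨A', rfl⟩, ⟨B, hB⟩⟩ := hA
  rw [ct, hB]
  have := lt_concat2 B b a
  simpa using this

lemma Ends.map {α β : Type*} (f : α → β) {A : List α} {a b : α} (hA : Ends a b A) :
    Ends (f a) (f b) (A.map f) := by
  obtain ⟨⟨A', rfl⟩, ⟨B, hB⟩⟩ := hA
  exact ⟨⟨A'.map f, by simp⟩, ⟨B.map f, by rw [hB]; simp⟩⟩

lemma Ends.reverse {α : Type*} {A : List α} {a b : α} (hA : Ends a b A) :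
    Ends b a A.reverse := by
  obtain ⟨⟨A', rfl⟩, ⟨B, hB⟩⟩ := hA
  exact ⟨⟨B.reverse, by rw [hB]; simp⟩, ⟨A'.reverse, by simp⟩⟩

lemma lt_not (A : List Bool) : lt (A.map not) = lt A := by
  induction A with
  | nil => rfl
  | cons a A ih =>
    cases A with
    | nil => rfl
    | cons b A => simp only [List.map_cons, lt] at ih ⊢; rw [ih]; simp

lemma lt_reverse (A : List Bool) : lt A.reverse = lt A := by
  induction A with
  | nil => rfl
  | cons a A ih =>
    cases A with
    | nil => rfl
    | cons b A =>
      have : (a :: b :: A).reverse = A.reverse ++ [b, a] := by simp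
      rw [this, lt_concat2]
      simp only [List.reverse_cons] at ih
      rw [ih, lt]
      simp only [eq_comm]; omega

end Bools

namespace QuiverData

section Words
variable (Q : QuiverData)

abbrev HE : Type := Q.A × Bool

def vert (h : Q.HE) : Q.V := match h with
  | (a, true) => Q.tgt a
  | (a, false) => Q.src a

def flp (h : Q.HE) : Q.HE := (h.1, !h.2)

@[simp] lemma flp_flp (h : Q.HE) : Q.flp (Q.flp h) = h := by simp [flp]
@[simp] lemma flp_fst (h : Q.HE) : (Q.flp h).1 = h.1 := rfl
@[simp] lemma flp_snd (h : Q.HE) : (Q.flp h).2 = !h.2 := rfl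

@[reducible] def dbl : QuiverData where
  V := Q.V
  A := Q.A × Bool
  src := fun h => Q.vert (Q.flp h)
  tgt := fun h => Q.vert h

def star (W : List Q.HE) : List Q.HE := (W.map Q.flp).reverse

variable {Q}

lemma star_path {u v : Q.V} {W : List Q.HE} (h : Q.dbl.IsPathFrom u v W) :
    Q.dbl.IsPathFrom v u (Q.star W) := by
  induction W generalizing u with
  | nil => exact Eq.symm h
  | cons x W ih =>
    obtain ⟨h1, h2⟩ := h
    have : Q.star (x :: W) = Q.star W ++ [Q.flp x] := by simp [star]
    rw [this]
    refine (ih h2).append ⟨?_, ?_⟩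
    · change Q.vert (Q.flp (Q.flp x)) = _
      rw [flp_flp]
    · exact h1

lemma star_snd (W : List Q.HE) : (Q.star W).map Prod.snd = ((W.map Prod.snd).map not).reverse := by
  simp [star, Function.comp_def]

variable (Q) (K : Type) [Field K]

noncomputable def dlet (h : Q.HE) : Matrix (Fin 2) (Fin 2) (MvPolynomial Q.Var K) :=
  match h with
  | (a, true) => Q.genMat K a
  | (a, false) => (Q.genMat K a).adjugate

lemma adj_adj {R : Type*} [CommRing R] (M : Matrix (Fin 2) (Fin 2) R) :
    M.adjugate.adjugate = M := by
  refine Matrix.ext fun i j => ?_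
  fin_cases i <;> fin_cases j <;> simp [Matrix.adjugate_fin_two]

lemma dlet_flp (h : Q.HE) : Q.dlet K (Q.flp h) = (Q.dlet K h).adjugate := by
  obtain ⟨a, _ | _⟩ := h
  · simp [dlet, flp, adj_adj]
  · simp [dlet, flp]

noncomputable def dmat (W : List Q.HE) := mprod (Q.dlet K) W
noncomputable def dtr (W : List Q.HE) := (Q.dmat K W).trace

lemma dmat_append (A B : List Q.HE) : Q.dmat K (A ++ B) = Q.dmat K B * Q.dmat K A :=
  mprod_append _ _ _

lemma dmat_star (W : List Q.HE) : Q.dmat K (Q.star W) = (Q.dmat K W).adjugate := by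
  induction W with
  | nil => simp [dmat, star]
  | cons x W ih =>
    have : Q.star (x :: W) = Q.star W ++ [Q.flp x] := by simp [star]
    rw [this, dmat_append, ih]
    simp only [dmat, mprod_cons, mprod_nil, Matrix.one_mul]
    rw [dlet_flp, Matrix.adjugate_mul_distrib]

lemma tr_adj {R : Type*} [CommRing R] (M : Matrix (Fin 2) (Fin 2) R) :
    M.adjugate.trace = M.trace := by
  simp [Matrix.adjugate_fin_two, Matrix.trace_fin_two, add_comm]

lemma tr_mul_adj {R : Type*} [CommRing R] (M N : Matrix (Fin 2) (Fin 2) R) :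
    M.trace * N.trace = (N * M).trace + (N.adjugate * M).trace := by
  simp [Matrix.adjugate_fin_two, Matrix.trace_fin_two, Matrix.mul_apply, Fin.sum_univ_two,
    Matrix.vecMul, dotProduct]
  ring

lemma dtr_star (W : List Q.HE) : Q.dtr K (Q.star W) = Q.dtr K W := by
  rw [dtr, dmat_star, tr_adj]; rfl

lemma dtr_rot (A B : List Q.HE) : Q.dtr K (A ++ B) = Q.dtr K (B ++ A) := by
  rw [dtr, dtr, dmat_append, dmat_append, Matrix.trace_mul_comm]

lemma dtr_mul (P R : List Q.HE) :
    Q.dtr K P * Q.dtr K R = Q.dtr K (P ++ R) + Q.dtr K (P ++ Q.star R) := by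
  simp only [dtr, dmat_append, dmat_star]
  exact tr_mul_adj _ _

lemma dtr_loop (W : List Q.HE) (a : Q.A) :
    Q.dtr K (W ++ [(a, true), (a, false)]) = (Q.genMat K a).det * Q.dtr K W := by
  have : Q.dmat K [(a, true), (a, false)] = (Q.genMat K a).det • 1 := by
    simp [dmat, dlet, Matrix.adjugate_mul]
  rw [dtr, dmat_append, this]
  simp [dtr]

/-- generator products -/
noncomputable def GP (e : Multiset Q.A) (Ws : Multiset (List Q.HE)) : MvPolynomial Q.Var K :=
  (e.map fun a => (Q.genMat K a).det).prod * (Ws.map (Q.dtr K)).prod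

/-- boundary of an arrow at `v` -/
noncomputable def bd (v : Q.V) (a : Q.A) : ℤ :=
  (if Q.tgt a = v then 1 else 0) - (if Q.src a = v then 1 else 0)

noncomputable def wbd (v : Q.V) (W : List Q.HE) : ℤ := (W.map fun h => Q.bd v h.1).sum

def Bal (e : Multiset Q.A) (Ws : Multiset (List Q.HE)) : Prop :=
  ∀ v, 2 * (e.map (Q.bd v)).sum + (Ws.map (Q.wbd v)).sum = 0

def AllClosed (Ws : Multiset (List Q.HE)) : Prop := ∀ W ∈ Ws, ∃ v, Q.dbl.IsPathFrom v v W

variable {Q}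

lemma wbd_append (v : Q.V) (A B : List Q.HE) : Q.wbd v (A ++ B) = Q.wbd v A + Q.wbd v B := by
  simp [wbd]

lemma wbd_star (v : Q.V) (A : List Q.HE) : Q.wbd v (Q.star A) = Q.wbd v A := by
  simp only [wbd, star, List.map_reverse, List.sum_reverse, List.map_map]
  rfl

/-- linear source -/
def LSrc (v : Q.V) (L : List Q.HE) : Prop :=
  ∃ A B c e, L = A ++ (c, false) :: (e, true) :: B ∧ Q.src c = v

noncomputable def EE (v : Q.V) (h : Q.HE) : ℤ := match h with
  | (a, true) => if Q.tgt a = v then 1 else 0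
  | (a, false) => - if Q.src a = v then 1 else 0
noncomputable def SS (v : Q.V) (h : Q.HE) : ℤ := match h with
  | (a, true) => - if Q.src a = v then 1 else 0
  | (a, false) => if Q.tgt a = v then 1 else 0

lemma bd_eq (v : Q.V) (h : Q.HE) : Q.bd v h.1 = SS v h + EE v h := by
  obtain ⟨a, _ | _⟩ := h
  · simp only [bd, SS, EE]; ring
  · simp only [bd, SS, EE]; ring

lemma junction {v : Q.V} {x y : Q.HE} (h : Q.vert (Q.flp y) = Q.vert x)
    (hn : ¬ (x.2 = false ∧ y.2 = true ∧ Q.vert x = v)) : 0 ≤ EE v x + SS v y := by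
  obtain ⟨a, _ | _⟩ := x <;> obtain ⟨b, _ | _⟩ := y <;> simp [vert, flp, EE, SS] at * <;>
    split_ifs <;> simp_all

lemma linear_sum {v : Q.V} (M : List Q.HE) : ∀ (x y : Q.HE) (u w : Q.V),
    Q.dbl.IsPathFrom u w (x :: M) → ¬ LSrc v (x :: M) → Ends x y (x :: M) →
    SS v x + EE v y ≤ Q.wbd v (x :: M) := by
  induction M with
  | nil =>
    intro x y u w _ _ he
    obtain ⟨_, B, hB⟩ := he
    have : x = y := by
      cases B with
      | nil => simpa using hB
      | cons b B => simp at hB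
    subst this
    simp [wbd, bd_eq]
  | cons z M ih =>
    intro x y u w hp hn he
    obtain ⟨_, B, hB⟩ := he
    cases B with
    | nil => simp at hB
    | cons b B =>
      simp only [List.cons_append, List.cons.injEq] at hB
      have h1 := ih z y (Q.vert x) w hp.2 (by
        rintro ⟨A, B, c, e, h, hc⟩
        exact hn ⟨x :: A, B, c, e, by rw [h]; rfl, hc⟩) ⟨⟨M, rfl⟩, ⟨B, hB.2⟩⟩
      have h2 := junction (v := v) (x := x) (y := z) hp.2.1 (by
        rintro ⟨h3, h4, h5⟩
        obtain ⟨c, _⟩ := x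
        obtain ⟨e, _⟩ := z
        simp only at h3 h4
        subst h3; subst h4
        exact hn ⟨[], M, c, e, rfl, h5⟩)
      have h3 : Q.wbd v (x :: z :: M) = SS v x + EE v x + Q.wbd v (z :: M) := by
        simp [wbd, bd_eq]
      rw [h3]; linarith

end Words
end QuiverData


namespace QuiverData

section Phase2
variable {Q : QuiverData} (K : Type) [Field K]

lemma last_sat {α : Type*} (p : α → Prop) (M : List α) (h : ∃ x ∈ M, p x) :
    ∃ M1 x M2, M = M1 ++ x :: M2 ∧ p x ∧ ∀ y ∈ M2, ¬ p y := by
  induction M with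
  | nil => simp at h
  | cons a M ih =>
    by_cases h' : ∃ x ∈ M, p x
    · obtain ⟨M1, x, M2, h1, h2, h3⟩ := ih h'
      exact ⟨a :: M1, x, M2, by rw [h1]; rfl, h2, h3⟩
    · refine ⟨[], a, M, rfl, ?_, by simpa using h'⟩
      obtain ⟨x, hx, hp⟩ := h
      rcases List.mem_cons.1 hx with rfl | hx
      · exact hp
      · exact absurd ⟨x, hx, hp⟩ h'

/-- a word with both signs can be rotated to have a sink at the wrap -/
lemma exists_sink {W : List Q.HE} (h1 : ∃ x ∈ W, x.2 = true) (h2 : ∃ x ∈ W, x.2 = false) :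
    ∃ A B x y, W = A ++ B ∧ Ends (x, false) (y, true) (B ++ A) := by
  obtain ⟨⟨c, _⟩, hc, hc'⟩ := h2
  simp only at hc'; subst hc'
  obtain ⟨A0, B0, rfl⟩ := List.append_of_mem hc
  have h3 : ∃ x ∈ B0 ++ A0, x.2 = true := by
    obtain ⟨x, hx, hxt⟩ := h1
    refine ⟨x, ?_, hxt⟩
    simp only [List.mem_append, List.mem_cons] at hx ⊢
    rcases hx with hx | hx | hx
    · exact Or.inr hx
    · subst hx; simp at hxt
    · exact Or.inl hx
  obtain ⟨M1, ⟨y, _⟩, M2, h4, h5, h6⟩ := last_sat _ _ h3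
  simp only at h5; subst h5
  -- rotated word `(c,false) :: M1 ++ (y,true) :: M2`
  have hE : ∃ x, Ends (x, false) (y, true) (M2 ++ (c, false) :: M1 ++ [(y, true)]) := by
    cases M2 with
    | nil => exact ⟨c, ⟨_, rfl⟩, ⟨_, rfl⟩⟩
    | cons z M2 =>
      obtain ⟨z, b⟩ := z
      have : b = false := by simpa using h6 (z, b) (by simp)
      subst this
      exact ⟨z, ⟨_, rfl⟩, ⟨_, rfl⟩⟩
  obtain ⟨x, hE⟩ := hE
  -- relation with W = A0 ++ (c,false) :: B0
  rcases List.append_eq_append_iff.1 h4 with ⟨T, h7, h8⟩ | ⟨T, h7, h8⟩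
  · -- A0 = T ++ (y,true)::M2, M1 = B0 ++ T
    subst h7
    refine ⟨T ++ [(y, true)], M2 ++ (c, false) :: B0, x, y, by rw [h8]; simp, ?_⟩
    simpa using hE
  · -- B0 = M1 ++ T, (y,true)::M2 = T ++ A0
    cases T with
    | nil =>
      simp only [List.nil_append] at h8
      simp only [List.append_nil] at h7
      subst h7
      refine ⟨[(y, true)], M2 ++ (c, false) :: B0, x, y, by rw [← h8]; simp, ?_⟩
      simpa using hE
    | cons t T =>
      simp only [List.cons_append, List.cons.injEq] at h8
      obtain ⟨h8, h9⟩ := h8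
      subst h8; subst h9; subst h7
      refine ⟨A0 ++ (c, false) :: M1 ++ [(y, true)], T, x, y, by simp, ?_⟩
      simpa using hE

lemma path_rot {u : Q.V} {A B : List Q.HE} (h : Q.dbl.IsPathFrom u u (A ++ B)) :
    ∃ v, Q.dbl.IsPathFrom v v (B ++ A) := by
  rw [isPathFrom_append] at h
  obtain ⟨v, h1, h2⟩ := h
  exact ⟨v, h2.append h1⟩

lemma end_vert {u v : Q.V} {x y : Q.HE} {L : List Q.HE} (h : Q.dbl.IsPathFrom u v L)
    (he : Ends x y L) : Q.vert (Q.flp x) = u ∧ Q.vert y = v := by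
  obtain ⟨⟨A, hA⟩, ⟨B, hB⟩⟩ := he
  constructor
  · rw [hA] at h; exact h.1
  · rw [hB, isPathFrom_append] at h
    obtain ⟨w, _, h2⟩ := h
    exact h2.2

/-- other words: either no source (nonnegative boundary), or rotate to wrap source. -/
lemma source_or {u v : Q.V} {W : List Q.HE} (h : Q.dbl.IsPathFrom u u W) :
    0 ≤ Q.wbd v W ∨ ∃ A B x y, W = A ++ B ∧ Ends (x, true) (y, false) (B ++ A) ∧
      Q.dbl.IsPathFrom v v (B ++ A) := by
  cases W with
  | nil => left; simp [wbd]
  | cons x M =>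
    by_cases hs : LSrc v (x :: M)
    · right
      obtain ⟨A, B, c, e, hAB, hc⟩ := hs
      refine ⟨A ++ [(c, false)], (e, true) :: B, e, c, by rw [hAB]; simp, ⟨⟨_, rfl⟩, ⟨(e, true) :: B ++ A, by simp⟩⟩, ?_⟩
      rw [hAB] at h
      have h' : Q.dbl.IsPathFrom u u ((A ++ [(c, false)]) ++ ((e, true) :: B)) := by simpa using h
      rw [isPathFrom_append] at h'
      obtain ⟨w, h1, h2⟩ := h'
      have : w = v := by
        rw [isPathFrom_append] at h1
        obtain ⟨w', _, h4⟩ := h1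
        rw [← hc]; exact h4.2.symm
      subst this
      exact h2.append h1
    · obtain ⟨y, hy⟩ : ∃ y, Ends x y (x :: M) :=
        ⟨(x :: M).getLast (by simp), ⟨M, rfl⟩, ⟨_, (List.dropLast_append_getLast _).symm⟩⟩
      have h1 := linear_sum M x y u u h hs hy
      have h2 := end_vert h hy
      by_cases hw : y.2 = false ∧ x.2 = true ∧ Q.vert y = v
      · right
        obtain ⟨y, _⟩ := y
        obtain ⟨x, _⟩ := x
        obtain ⟨h3, h4, h5⟩ := hw
        simp only at h3 h4
        subst h3; subst h4
        have : u = v := by rw [← h2.2, h5]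
        subst this
        exact ⟨[], _, x, y, rfl, by simpa using hy, by simpa using h⟩
      · left
        have := junction (v := v) (h2.1.trans h2.2.symm) hw
        linarith

/-- all forward words -/
lemma forward_word {W : List Q.HE} (h : ∀ x ∈ W, x.2 = true) :
    ∃ l : List Q.A, W = l.map (fun a => (a, true)) := by
  refine ⟨W.map Prod.fst, ?_⟩
  rw [List.map_map]
  conv_lhs => rw [← List.map_id W]
  refine List.map_congr_left fun x hx => ?_
  obtain ⟨a, b⟩ := x
  have := h _ hx
  simp only at this; subst this; rfl

lemma forward_path {u v : Q.V} {l : List Q.A} :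
    Q.dbl.IsPathFrom u v (l.map (fun a => (a, true))) → Q.IsPathFrom u v l := by
  induction l generalizing u with
  | nil => exact id
  | cons a l ih => exact fun h => ⟨h.1, ih h.2⟩

lemma path_bd {u w : Q.V} {l : List Q.A} (v : Q.V) (h : Q.IsPathFrom u w l) :
    (l.map (Q.bd v)).sum = (if w = v then 1 else 0) - (if u = v then 1 else 0) := by
  induction l generalizing u with
  | nil => simp at h; subst h; simp
  | cons a l ih =>
    obtain ⟨h1, h2⟩ := h
    subst h1
    rw [List.map_cons, List.sum_cons, ih h2, bd]; ring

lemma forward_tr (l : List Q.A) : Q.dtr K (l.map (fun a => (a, true))) = Q.pathTr K l := by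
  rw [dtr, pathTr, pathMat_eq, dmat]
  congr 1
  simp only [mprod, List.map_map]
  rfl

noncomputable def TT (Q : QuiverData) (K : Type) [Field K] := Algebra.adjoin K (gens Q K)

lemma mono_word [CharP K 2] {u : Q.V} {W : List Q.HE} (hW : Q.dbl.IsPathFrom u u W)
    (h : (∀ x ∈ W, x.2 = true) ∨ (∀ x ∈ W, x.2 = false)) :
    Q.dtr K W ∈ TT Q K ∧ ∀ v, Q.wbd v W = 0 := by
  wlog h1 : ∀ x ∈ W, x.2 = true generalizing W
  · have h2 : ∀ x ∈ W, x.2 = false := h.resolve_left h1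
    have h3 : ∀ x ∈ Q.star W, x.2 = true := by
      intro x hx
      simp only [star, List.mem_reverse, List.mem_map] at hx
      obtain ⟨y, hy, rfl⟩ := hx
      simp [h2 y hy]
    have := this (star_path hW) (Or.inl h3) h3
    rw [dtr_star] at this
    simpa only [wbd_star] using this
  obtain ⟨l, rfl⟩ := forward_word h1
  have hp := forward_path hW
  constructor
  · rw [forward_tr]
    by_cases h0 : l = []
    · subst h0
      have : Q.pathTr K [] = 0 := by
        simp only [pathTr, pathMat_eq, mprod_nil, Matrix.trace_one, Fintype.card_fin]
        exact CharP.cast_eq_zero _ 2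
      rw [this]; exact Subalgebra.zero_mem _
    · exact Algebra.subset_adjoin ⟨l, ⟨u, h0, hp⟩, Or.inl rfl⟩
  · intro v
    have := path_bd v hp
    simp only [sub_self] at this
    simpa [wbd, Function.comp_def] using this

/-- balanced multisets contain closed paths -/
lemma exists_closed {e : Multiset Q.A} (hb : ∀ v, (e.map (Q.bd v)).sum = 0) (n : ℕ) :
    ∀ (u w : Q.V) (l : List Q.A), Q.IsPathFrom u w l → l ≠ [] → (l : Multiset Q.A) ≤ e →
      Multiset.card e ≤ n + l.length →
      ∃ v l', Q.IsClosedAt v l' ∧ (l' : Multiset Q.A) ≤ e := by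
  induction n with
  | zero =>
    intro u w l hp h0 hle hc
    have : (l : Multiset Q.A) = e := Multiset.eq_of_le_of_card_le hle (by simpa using hc)
    refine ⟨u, l, ⟨h0, ?_⟩, hle⟩
    have h1 := path_bd w hp
    have h2 := hb w
    rw [← this, Multiset.map_coe, Multiset.sum_coe, h1] at h2
    have : u = w := by
      by_contra hne
      simp [hne] at h2
    subst this; exact hp
  | succ n ih =>
    intro u w l hp h0 hle hc
    by_cases huw : u = w
    · subst huw; exact ⟨u, l, ⟨h0, hp⟩, hle⟩
    have h1 := path_bd w hp
    have h2 := hb w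
    obtain ⟨e', rfl⟩ := Multiset.le_iff_exists_add.1 hle
    rw [Multiset.map_add, Multiset.sum_add, Multiset.map_coe, Multiset.sum_coe, h1] at h2
    simp [huw] at h2
    have : ∃ a ∈ e', Q.src a = w := by
      by_contra hh
      push Not at hh
      have : 0 ≤ (e'.map (Q.bd w)).sum := by
        refine Multiset.sum_nonneg fun x hx => ?_
        obtain ⟨a, ha, rfl⟩ := Multiset.mem_map.1 hx
        simp only [bd, hh a ha, if_false]
        split_ifs <;> simp
      omega
    obtain ⟨a, ha, has⟩ := this
    refine ih u (Q.tgt a) (l ++ [a]) (hp.append ⟨has, rfl⟩) (by simp) ?_ (by simp at hc ⊢; omega)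
    rw [← Multiset.coe_add]
    exact Multiset.add_le_add_left (by simpa using ha)

lemma pathDet_prod (l : List Q.A) :
    Q.pathDet K l = (l.map fun a => (Q.genMat K a).det).prod := by
  rw [pathDet, pathMat_eq]
  induction l with
  | nil => simp
  | cons a l ih => rw [mprod_cons, Matrix.det_mul, ih, List.map_cons, List.prod_cons, mul_comm]

lemma det_in_T (n : ℕ) : ∀ (e : Multiset Q.A), Multiset.card e ≤ n →
    (∀ v, (e.map (Q.bd v)).sum = 0) → (e.map fun a => (Q.genMat K a).det).prod ∈ TT Q K := by
  induction n with
  | zero =>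
    intro e he _
    have : e = 0 := Multiset.card_eq_zero.1 (by omega)
    subst this; simp
  | succ n ih =>
    intro e he hb
    by_cases h0 : e = 0
    · subst h0; simp
    obtain ⟨a, ha⟩ := Multiset.exists_mem_of_ne_zero h0
    obtain ⟨v, l, hl, hle⟩ := exists_closed hb (Multiset.card e) (Q.src a) (Q.tgt a) [a]
      ⟨rfl, rfl⟩ (by simp) (by simpa using ha) (by omega)
    obtain ⟨e', rfl⟩ := Multiset.le_iff_exists_add.1 hle
    rw [Multiset.map_add, Multiset.prod_add, Multiset.map_coe, Multiset.prod_coe, ← pathDet_prod]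
    have hlen := List.length_pos_iff.2 hl.1
    refine Subalgebra.mul_mem _ (Algebra.subset_adjoin ⟨l, ⟨v, hl⟩, Or.inr rfl⟩)
      (ih e' (by simp at he; omega) fun w => ?_)
    have h1 := hb w
    have h2 := path_bd w hl.2
    rw [Multiset.map_add, Multiset.sum_add, Multiset.map_coe, Multiset.sum_coe, h2] at h1
    simpa using h1

noncomputable def tct (Ws : Multiset (List Q.HE)) : ℕ := (Ws.map fun W => ct (W.map Prod.snd)).sum

theorem phase2 [CharP K 2] (n : ℕ) : ∀ (e : Multiset Q.A) (Ws : Multiset (List Q.HE)),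
    tct Ws + Multiset.card e ≤ n → Q.AllClosed Ws → Q.Bal e Ws → Q.GP K e Ws ∈ TT Q K := by
  induction n using Nat.strong_induction_on with
  | _ n ih =>
  intro e Ws hn hcl hbal
  by_cases hmono : ∀ W ∈ Ws, (∀ x ∈ W, x.2 = true) ∨ (∀ x ∈ W, x.2 = false)
  · -- terminal case
    refine Subalgebra.mul_mem _ ?_ ?_
    · refine det_in_T K _ e le_rfl fun v => ?_
      have h1 := hbal v
      have h2 : (Ws.map (Q.wbd v)).sum = 0 := by
        refine Multiset.sum_eq_zero fun x hx => ?_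
        obtain ⟨W, hW, rfl⟩ := Multiset.mem_map.1 hx
        obtain ⟨u, hu⟩ := hcl W hW
        exact (mono_word K hu (hmono W hW)).2 v
      omega
    · refine Subalgebra.multiset_prod_mem _ fun x hx => ?_
      obtain ⟨W, hW, rfl⟩ := Multiset.mem_map.1 hx
      obtain ⟨u, hu⟩ := hcl W hW
      exact (mono_word K hu (hmono W hW)).1
  push Not at hmono
  obtain ⟨W, hW, ⟨x1, hx1, hx1'⟩, x2, hx2, hx2'⟩ := hmono
  obtain ⟨Ws', rfl⟩ := Multiset.exists_cons_of_mem hW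
  obtain ⟨A, B, x, y, rfl, hE⟩ := exists_sink ⟨x2, hx2, by simpa using hx2'⟩
    ⟨x1, hx1, by simpa using hx1'⟩
  obtain ⟨u, hu⟩ := hcl _ hW
  obtain ⟨v, hv⟩ : ∃ v : Q.V, Q.dbl.IsPathFrom v v (B ++ A) := path_rot hu
  have hcl' : Q.AllClosed Ws' := fun W hW => hcl W (Multiset.mem_cons_of_mem hW)
  -- replace `A ++ B` by the rotated word
  have r1 : Q.GP K e ((A ++ B) ::ₘ Ws') = Q.GP K e ((B ++ A) ::ₘ Ws') := by
    simp only [GP, Multiset.map_cons]; rw [dtr_rot]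
  have r2 : tct ((A ++ B) ::ₘ Ws') = ct ((B ++ A).map Prod.snd) + tct Ws' := by
    simp only [tct, Multiset.map_cons, Multiset.sum_cons, List.map_append]; rw [ct_rot]
  have r3 : ∀ w, 2 * (e.map (Q.bd w)).sum + (Q.wbd w (B ++ A) + (Ws'.map (Q.wbd w)).sum) = 0 := by
    intro w
    have := hbal w
    rw [Multiset.map_cons, Multiset.sum_cons, wbd_append] at this
    rw [wbd_append]; linarith
  rw [r1]
  rw [r2] at hn
  clear r1 r2 hbal hcl hu hx1 hx2 hW
  generalize hL : B ++ A = L at *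
  have hEb := hE.map Prod.snd
  simp only at hEb
  have hctL : ct (L.map Prod.snd) = lt (L.map Prod.snd) + 1 := by
    rw [ct_of_ends hEb]; simp
  have hvy := end_vert hv hE
  by_cases hs : LSrc v L
  · -- source in the same word
    obtain ⟨P0, R0, c, e', hLe, hc⟩ := hs
    obtain ⟨P, hP⟩ : ∃ P, P = P0 ++ [(c, false)] := ⟨_, rfl⟩
    obtain ⟨R, hR⟩ : ∃ R, R = (e', true) :: R0 := ⟨_, rfl⟩
    have hPR : L = P ++ R := by rw [hLe, hP, hR]; simp
    have hEP : Ends (x, false) (c, false) P := by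
      refine ⟨?_, ⟨P0, hP⟩⟩
      obtain ⟨⟨D, hD⟩, _⟩ := hE
      rw [hLe] at hD
      cases P0 with
      | nil => simp at hD; exact ⟨[], by rw [hP, hD.1]; rfl⟩
      | cons p P0 => simp at hD; exact ⟨P0 ++ [(c, false)], by rw [hP, hD.1]; rfl⟩
    have hER : Ends (e', true) (y, true) R := by
      refine ⟨⟨R0, hR⟩, ?_⟩
      obtain ⟨_, ⟨D, hD⟩⟩ := hE
      have hR0 : R ≠ [] := by rw [hR]; simp
      refine ⟨R.dropLast, ?_⟩
      have h1 : R.getLast hR0 = (y, true) := by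
        have : L.getLast (by rw [hD]; simp) = (y, true) := by simp [hD]
        rw [← this]
        simp only [hPR]
        rw [List.getLast_append_of_right_ne_nil]
      rw [← h1]; exact (List.dropLast_append_getLast _).symm
    have hpaths : Q.dbl.IsPathFrom v v P ∧ Q.dbl.IsPathFrom v v R := by
      rw [hPR, isPathFrom_append] at hv
      obtain ⟨w, h1, h2⟩ := hv
      have : w = v := by rw [← (end_vert h1 hEP).2]; exact hc
      subst this; exact ⟨h1, h2⟩
    have hEPb := hEP.map Prod.snd
    have hERb := hER.map Prod.snd
    simp only at hEPb hERb
    have hlt : lt (L.map Prod.snd) = lt (P.map Prod.snd) + 1 + lt (R.map Prod.snd) := by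
      rw [hPR, List.map_append, lt_join hEPb hERb]; simp
    have hsb : Ends false false ((Q.star R).map Prod.snd) := by
      rw [star_snd]
      exact (hERb.map not).reverse
    have e1 : Q.GP K e (L ::ₘ Ws') =
        Q.GP K e (P ::ₘ R ::ₘ Ws') - Q.GP K e ((P ++ Q.star R) ::ₘ Ws') := by
      simp only [GP, Multiset.map_cons, Multiset.prod_cons]
      have := dtr_mul Q K P R
      rw [hPR, ← mul_assoc (Q.dtr K P), this]; ring
    rw [e1]
    refine Subalgebra.sub_mem _ ?_ ?_
    · refine ih (n - 1) (by omega) _ _ ?_ ?_ ?_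
      · have h1 := ct_of_ends hEPb
        have h2 := ct_of_ends hERb
        simp only [tct, Multiset.map_cons, Multiset.sum_cons] at hn ⊢
        rw [h1, h2]
        simp only [if_true]
        omega
      · intro W hW
        rcases Multiset.mem_cons.1 hW with rfl | hW
        · exact ⟨v, hpaths.1⟩
        rcases Multiset.mem_cons.1 hW with rfl | hW
        · exact ⟨v, hpaths.2⟩
        · exact hcl' W hW
      · intro w
        have := r3 w
        rw [hPR, wbd_append] at this
        simp only [Multiset.map_cons, Multiset.sum_cons]; linarith
    · refine ih (n - 1) (by omega) _ _ ?_ ?_ ?_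
      · have h1 := ct_of_ends (hEPb.join hsb)
        have h2 := lt_join hEPb hsb
        have h3 : lt ((Q.star R).map Prod.snd) = lt (R.map Prod.snd) := by
          rw [star_snd, lt_reverse, lt_not]
        simp only [tct, Multiset.map_cons, Multiset.sum_cons, List.map_append] at hn ⊢
        rw [h1, h2, h3]
        simp only [if_true]
        omega
      · intro W hW
        rcases Multiset.mem_cons.1 hW with rfl | hW
        · exact ⟨v, hpaths.1.append (star_path hpaths.2)⟩
        · exact hcl' W hW
      · intro w
        have := r3 w
        rw [hPR, wbd_append] at this
        simp only [Multiset.map_cons, Multiset.sum_cons, wbd_append, wbd_star]; linarith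
  by_cases hs2 : ∀ W ∈ Ws', 0 ≤ Q.wbd v W
  · -- a determinant
    have h1 : 0 < Q.wbd v L := by
      obtain ⟨D, hD⟩ := hE.1
      rw [hD] at hs hv hE ⊢
      have := linear_sum (v := v) D _ _ v v hv hs hE
      have h2 : EE v (y, true) = 1 := by
        simp only [EE]; exact if_pos hvy.2
      have h3 : SS v (x, false) = 1 := by
        simp only [SS]; exact if_pos hvy.1
      omega
    have h2 : 0 ≤ (Ws'.map (Q.wbd v)).sum := by
      refine Multiset.sum_nonneg fun x hx => ?_
      obtain ⟨W, hW, rfl⟩ := Multiset.mem_map.1 hx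
      exact hs2 W hW
    have h3 := r3 v
    have : ∃ a ∈ e, Q.src a = v := by
      by_contra hh
      push Not at hh
      have : 0 ≤ (e.map (Q.bd v)).sum := by
        refine Multiset.sum_nonneg fun x hx => ?_
        obtain ⟨a, ha, rfl⟩ := Multiset.mem_map.1 hx
        simp only [bd, hh a ha, if_false]
        split_ifs <;> simp
      omega
    obtain ⟨a, ha, has⟩ := this
    obtain ⟨e', rfl⟩ := Multiset.exists_cons_of_mem ha
    have e1 : Q.GP K (a ::ₘ e') (L ::ₘ Ws') =
        Q.GP K e' ((L ++ [(a, true), (a, false)]) ::ₘ Ws') := by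
      simp only [GP, Multiset.map_cons, Multiset.prod_cons, dtr_loop]; ring
    rw [e1]
    simp only [Multiset.card_cons] at hn
    refine ih (n - 1) (by omega) _ _ ?_ ?_ ?_
    · have hEa : Ends true false [true, false] := ⟨⟨_, rfl⟩, ⟨[true], rfl⟩⟩
      have h1 := ct_of_ends (hEb.join hEa)
      have h2 := lt_join hEb hEa
      simp only [tct, Multiset.map_cons, Multiset.sum_cons, List.map_append, List.map_nil,
        List.map_cons] at hn ⊢
      rw [h1, h2]
      simp only [lt, if_true, reduceCtorEq, if_false]
      omega
    · intro W hW
      rcases Multiset.mem_cons.1 hW with rfl | hW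
      · exact ⟨v, hv.append ⟨has, rfl, has⟩⟩
      · exact hcl' W hW
    · intro w
      have := r3 w
      simp only [Multiset.map_cons, Multiset.sum_cons, wbd_append] at this ⊢
      have h4 : Q.wbd w [(a, true), (a, false)] = 2 * Q.bd w a := by simp [wbd]; ring
      rw [h4]; linarith
  · push Not at hs2
    obtain ⟨W2, hW2, hneg⟩ := hs2
    obtain ⟨Ws'', rfl⟩ := Multiset.exists_cons_of_mem hW2
    obtain ⟨u2, hu2⟩ := hcl' _ hW2
    rcases source_or (Q := Q) (v := v) hu2 with h0 | ⟨A2, B2, x2, y2, rfl, hE2, hp2⟩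
    · omega
    have hcl'' : Q.AllClosed Ws'' := fun W hW => hcl' W (Multiset.mem_cons_of_mem hW)
    have q1 : Q.dtr K (A2 ++ B2) = Q.dtr K (B2 ++ A2) := dtr_rot _ _ _ _
    have q2 : ct ((A2 ++ B2).map Prod.snd) = ct ((B2 ++ A2).map Prod.snd) := by
      rw [List.map_append, List.map_append, ct_rot]
    have q3 : ∀ w, Q.wbd w (A2 ++ B2) = Q.wbd w (B2 ++ A2) := by
      intro w; rw [wbd_append, wbd_append, add_comm]
    have e1 : Q.GP K e (L ::ₘ (A2 ++ B2) ::ₘ Ws'') =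
        Q.GP K e ((L ++ (B2 ++ A2)) ::ₘ Ws'') + Q.GP K e ((L ++ Q.star (B2 ++ A2)) ::ₘ Ws'') := by
      simp only [GP, Multiset.map_cons, Multiset.prod_cons]
      rw [q1, ← mul_assoc (Q.dtr K L), dtr_mul]; ring
    rw [e1]
    simp only [tct, Multiset.map_cons, Multiset.sum_cons, q2] at hn
    simp only [Multiset.map_cons, Multiset.sum_cons, q3] at r3
    generalize B2 ++ A2 = R at *
    have hERb := hE2.map Prod.snd
    simp only at hERb
    have hctR : ct (R.map Prod.snd) = lt (R.map Prod.snd) + 1 := by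
      rw [ct_of_ends hERb]; simp
    have hsb : Ends true false ((Q.star R).map Prod.snd) := by
      rw [star_snd]
      exact (hERb.map not).reverse
    refine Subalgebra.add_mem _ ?_ ?_
    · refine ih (n - 1) (by omega) _ _ ?_ ?_ ?_
      · have h1 := ct_of_ends (hEb.join hERb)
        have h2 := lt_join hEb hERb
        simp only [tct, Multiset.map_cons, Multiset.sum_cons, List.map_append] at hn ⊢
        rw [h1, h2]
        simp only [if_true]
        omega
      · intro W hW
        rcases Multiset.mem_cons.1 hW with rfl | hW
        · exact ⟨v, hv.append hp2⟩
        · exact hcl'' W hW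
      · intro w
        have := r3 w
        simp only [Multiset.map_cons, Multiset.sum_cons, wbd_append]; linarith
    · refine ih (n - 1) (by omega) _ _ ?_ ?_ ?_
      · have h1 := ct_of_ends (hEb.join hsb)
        have h2 := lt_join hEb hsb
        have h3 : lt ((Q.star R).map Prod.snd) = lt (R.map Prod.snd) := by
          rw [star_snd, lt_reverse, lt_not]
        simp only [tct, Multiset.map_cons, Multiset.sum_cons, List.map_append] at hn ⊢
        rw [h1, h2, h3]
        simp only [if_true]
        omega
      · intro W hW
        rcases Multiset.mem_cons.1 hW with rfl | hW
        · exact ⟨v, hv.append (star_path hp2)⟩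
        · exact hcl'' W hW
      · intro w
        have := r3 w
        simp only [Multiset.map_cons, Multiset.sum_cons, wbd_append, wbd_star]; linarith

end Phase2
end QuiverData


/-! ### Generic tools for weighted homogeneous polynomials -/

section WH
open MvPolynomial
variable {K : Type*} [Field K] {σ τ M : Type*} [AddCommMonoid M]

lemma wh_map_monomial {w : σ → M} {w' : τ → M} (Φ : MvPolynomial σ K →ₐ[K] MvPolynomial τ K)
    (hΦ : ∀ i, IsWeightedHomogeneous w' (Φ (X i)) (w i)) (u : σ →₀ ℕ) (c : K) :
    IsWeightedHomogeneous w' (Φ (monomial u c)) (Finsupp.weight w u) := by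
  rw [monomial_eq, map_mul, Finsupp.prod, map_prod, Finsupp.weight_apply]
  have h1 : IsWeightedHomogeneous w' (Φ (C c)) 0 := by
    have : Φ (C c) = C c := by
      rw [← algebraMap_eq, AlgHom.commutes, algebraMap_eq]
    rw [this]
    exact isWeightedHomogeneous_C w' c
  have h2 := IsWeightedHomogeneous.prod (w := w') u.support (fun i => Φ (X i ^ u i))
    (fun i => u i • w i) (fun i _ => by rw [map_pow]; exact (hΦ i).pow _)
  have := h1.mul h2
  rwa [zero_add] at this

lemma whc_of_wh {w : σ → M} {f : MvPolynomial σ K} {n : M} (h : IsWeightedHomogeneous w f n) (m : M) :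
    weightedHomogeneousComponent w m f = if m = n then f else 0 :=
  weightedHomogeneousComponent_of_mem ((mem_weightedHomogeneousSubmodule K w n f).2 h)

lemma whc_map {w : σ → M} {w' : τ → M} (Φ : MvPolynomial σ K →ₐ[K] MvPolynomial τ K)
    (hΦ : ∀ i, IsWeightedHomogeneous w' (Φ (X i)) (w i)) (f : MvPolynomial σ K) (n : M) :
    weightedHomogeneousComponent w' n (Φ f) = Φ (weightedHomogeneousComponent w n f) := by
  induction f using MvPolynomial.induction_on' with
  | monomial u a =>
    rw [whc_of_wh (wh_map_monomial Φ hΦ u a), whc_of_wh (isWeightedHomogeneous_monomial w u a rfl)]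
    split_ifs <;> simp
  | add p q hp hq => simp only [map_add, hp, hq]

lemma wh_map {w : σ → M} {w' : τ → M} (Φ : MvPolynomial σ K →ₐ[K] MvPolynomial τ K)
    (hΦ : ∀ i, IsWeightedHomogeneous w' (Φ (X i)) (w i)) {f : MvPolynomial σ K} {n : M}
    (hf : IsWeightedHomogeneous w f n) : IsWeightedHomogeneous w' (Φ f) n := by
  have h := whc_map Φ hΦ f n
  rw [whc_of_wh hf n, if_pos rfl] at h
  rw [← h]
  exact weightedHomogeneousComponent_isWeightedHomogeneous n (Φ f)

lemma wh_theta {N : Type*} [AddCommMonoid N] (θ : M →+ N) {w : σ → M} {f : MvPolynomial σ K} {n : M}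
    (hf : IsWeightedHomogeneous w f n) : IsWeightedHomogeneous (fun i => θ (w i)) f (θ n) := by
  intro d hd
  rw [← hf hd, Finsupp.weight_apply, Finsupp.weight_apply, Finsupp.sum, Finsupp.sum, map_sum]
  simp

lemma whc_mul [IsCancelAdd M] {w : σ → M} {p : MvPolynomial σ K} {m : M}
    (hp : IsWeightedHomogeneous w p m) (g : MvPolynomial σ K) (n : M) :
    weightedHomogeneousComponent w (m + n) (p * g) = p * weightedHomogeneousComponent w n g := by
  induction g using MvPolynomial.induction_on' with
  | monomial u a =>
    have h1 := isWeightedHomogeneous_monomial w u a rfl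
    rw [whc_of_wh h1, whc_of_wh (hp.mul h1)]
    simp only [add_right_inj]
    split_ifs <;> simp
  | add p q hp hq => simp only [map_add, mul_add, hp, hq]

lemma whc_mul_zero {w : σ → M} {p : MvPolynomial σ K} {m : M}
    (hp : IsWeightedHomogeneous w p m) (g : MvPolynomial σ K) (r : M) (hr : ∀ n, r ≠ m + n) :
    weightedHomogeneousComponent w r (p * g) = 0 := by
  induction g using MvPolynomial.induction_on' with
  | monomial u a =>
    have h1 := isWeightedHomogeneous_monomial w u a rfl
    rw [whc_of_wh (hp.mul h1), if_neg (hr _)]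
  | add p q hp hq => simp only [map_add, mul_add, hp, hq, zero_add]

lemma whc_self {w : σ → M} {f : MvPolynomial σ K} {n : M} (h : IsWeightedHomogeneous w f n) :
    weightedHomogeneousComponent w n f = f := by rw [whc_of_wh h, if_pos rfl]

lemma wh_scale {w : σ → M} (χ : M → K) (h0 : χ 0 = 1) (ha : ∀ a b, χ (a + b) = χ a * χ b)
    {f : MvPolynomial σ K} {n : M} (hf : IsWeightedHomogeneous w f n) :
    aeval (fun i => C (χ (w i)) * X i : σ → MvPolynomial σ K) f = C (χ n) * f := by
  have key : ∀ u : σ →₀ ℕ, ∀ a : K,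
      aeval (fun i => C (χ (w i)) * X i : σ → MvPolynomial σ K) (monomial u a) =
        C (χ (Finsupp.weight w u)) * monomial u a := by
    intro u a
    have hs : ∀ (s : Finset σ) (v : σ → M), χ (∑ i ∈ s, v i) = ∏ i ∈ s, χ (v i) := by
      intro s v
      induction s using Finset.induction_on with
      | empty => simpa using h0
      | insert i s hi ih => rw [Finset.sum_insert hi, Finset.prod_insert hi, ha, ih]
    have hn : ∀ (k : ℕ) (v : M), χ (k • v) = χ v ^ k := by
      intro k v
      induction k with
      | zero => simpa using h0
      | succ k ih => rw [succ_nsmul, ha, ih, pow_succ]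
    rw [aeval_monomial, monomial_eq, algebraMap_eq, Finsupp.weight_apply, Finsupp.sum, hs,
      Finsupp.prod, Finsupp.prod]
    simp only [mul_pow, Finset.prod_mul_distrib, hn, map_prod, map_pow]
    ring
  have h2 : f = ∑ u ∈ f.support, monomial u (coeff u f) := f.as_sum
  conv_lhs => rw [h2]
  conv_rhs => rw [h2]
  rw [map_sum, Finset.mul_sum]
  refine Finset.sum_congr rfl fun u hu => ?_
  rw [key, hf (mem_support_iff.1 hu)]

lemma wh_scale_eval {w : σ → M} (χ : M → K) (h0 : χ 0 = 1) (ha : ∀ a b, χ (a + b) = χ a * χ b)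
    {f : MvPolynomial σ K} {n : M} (hf : IsWeightedHomogeneous w f n) (z : σ → K) :
    eval (fun i => χ (w i) * z i) f = χ n * eval z f := by
  have h := congrArg (eval z) (wh_scale χ h0 ha hf)
  rw [map_mul, eval_C] at h
  rw [← h, ← coe_aeval_eq_eval, ← coe_aeval_eq_eval]
  change _ = ((aeval z).comp (aeval _)) f
  rw [comp_aeval]
  simp

/-- kernels of monomial maps. -/
lemma ker_monomial (Φ : MvPolynomial σ K →ₗ[K] MvPolynomial τ K) (φ : (σ →₀ ℕ) → (τ →₀ ℕ))
    (hφ : ∀ s, Φ (monomial s 1) = monomial (φ s) 1) (I : Submodule K (MvPolynomial σ K))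
    (h : MvPolynomial σ K)
    (hI : ∀ s ∈ h.support, ∀ s' ∈ h.support, φ s = φ s' → monomial s 1 - monomial s' 1 ∈ I)
    (h0 : Φ h = 0) : h ∈ I := by
  let rep : (τ →₀ ℕ) → (σ →₀ ℕ) := fun t =>
    if ht : ∃ s ∈ h.support, φ s = t then ht.choose else 0
  have hrep : ∀ s ∈ h.support, rep (φ s) ∈ h.support ∧ φ (rep (φ s)) = φ s := by
    intro s hs
    have ht : ∃ s' ∈ h.support, φ s' = φ s := ⟨s, hs, rfl⟩
    have : rep (φ s) = ht.choose := dif_pos ht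
    rw [this]
    exact ht.choose_spec
  let Ψ := (basisMonomials τ K).constr K (fun t => monomial (rep t) (1 : K))
  have hΨ : ∀ t, Ψ (monomial t 1) = monomial (rep t) 1 := by
    intro t
    have := (basisMonomials τ K).constr_basis K (fun t => monomial (rep t) (1 : K)) t
    rwa [coe_basisMonomials] at this
  have hsum : h = ∑ s ∈ h.support, coeff s h • monomial s (1 : K) := by
    conv_lhs => rw [h.as_sum]
    refine Finset.sum_congr rfl fun s _ => ?_
    rw [smul_monomial, smul_eq_mul, mul_one]
  have h1 : Ψ (Φ h) = ∑ s ∈ h.support, coeff s h • monomial (rep (φ s)) (1 : K) := by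
    conv_lhs => rw [hsum]
    simp only [map_sum, map_smul, hφ, hΨ]
  rw [h0, map_zero] at h1
  have h2 : h = ∑ s ∈ h.support, coeff s h • (monomial s (1 : K) - monomial (rep (φ s)) (1 : K)) := by
    simp only [smul_sub, Finset.sum_sub_distrib]
    rw [← h1, sub_zero]
    exact hsum
  rw [h2]
  refine Submodule.sum_mem _ fun s hs => Submodule.smul_mem _ _ ?_
  exact hI s hs _ (hrep s hs).1 (hrep s hs).2.symm

lemma rowcol {R : Type*} [CommRing R] {a b c d : R} (h : a * d = b * c) {i j k l i' j' k' l' : ℕ}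
    (h1 : i + j = i' + j') (h2 : k + l = k' + l') (h3 : i + k = i' + k') :
    a ^ i * b ^ j * c ^ k * d ^ l = a ^ i' * b ^ j' * c ^ k' * d ^ l' := by
  have key : ∀ i j k l t : ℕ, a ^ i * b ^ (j + t) * c ^ (k + t) * d ^ l =
      a ^ (i + t) * b ^ j * c ^ k * d ^ (l + t) := by
    intro i j k l t
    have : b ^ t * c ^ t = a ^ t * d ^ t := by rw [← mul_pow, ← mul_pow, h]
    calc a ^ i * b ^ (j + t) * c ^ (k + t) * d ^ l
        = a ^ i * b ^ j * c ^ k * d ^ l * (b ^ t * c ^ t) := by ring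
      _ = _ := by rw [this]; ring
  rcases le_total i i' with hi | hi
  · obtain ⟨t, rfl⟩ := Nat.exists_eq_add_of_le hi
    obtain rfl : j = j' + t := by omega
    obtain rfl : k = k' + t := by omega
    obtain rfl : l' = l + t := by omega
    exact key _ _ _ _ _
  · obtain ⟨t, rfl⟩ := Nat.exists_eq_add_of_le hi
    obtain rfl : j' = j + t := by omega
    obtain rfl : k' = k + t := by omega
    obtain rfl : l = l' + t := by omega
    exact (key _ _ _ _ _).symm

end WH


/-! ### First fundamental theorem for products of `SL₂` in characteristic two -/

section FFT
set_option linter.unusedSectionVars false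
open MvPolynomial
variable (K : Type*) [Field K] {H V : Type*} (vert : H → V)

noncomputable def actZ (g : V → Matrix (Fin 2) (Fin 2) K) :
    MvPolynomial (H × Fin 2) K →ₐ[K] MvPolynomial (H × Fin 2) K :=
  aeval fun p => ∑ j : Fin 2, C (g (vert p.1) p.2 j) * X (p.1, j)

noncomputable def br (h h' : H) : MvPolynomial (H × Fin 2) K :=
  X (h, 0) * X (h', 1) + X (h, 1) * X (h', 0)

noncomputable def BP (L : Multiset (H × H)) : MvPolynomial (H × Fin 2) K :=
  (L.map fun p => br K p.1 p.2).prod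

def entries (L : Multiset (H × H)) : Multiset H := (L.map fun p => ({p.1} + {p.2} : Multiset H)).sum

def wZ (p : H × Fin 2) : Multiset H := {p.1}

def SLinv (f : MvPolynomial (H × Fin 2) K) : Prop :=
  ∀ g : V → Matrix (Fin 2) (Fin 2) K, (∀ v, (g v).det = 1) → actZ K vert g f = f

variable {K vert}

lemma br_comm (h h' : H) : br K h h' = br K h' h := by
  unfold br; ring

lemma entries_cons (p : H × H) (L : Multiset (H × H)) :
    entries (p ::ₘ L) = p.1 ::ₘ p.2 ::ₘ entries L := by
  simp [entries, Multiset.singleton_add]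

lemma entries_zero : entries (0 : Multiset (H × H)) = 0 := by simp [entries]

lemma BP_cons (p : H × H) (L : Multiset (H × H)) : BP K (p ::ₘ L) = br K p.1 p.2 * BP K L := by
  simp [BP]

lemma br_wh (h h' : H) : IsWeightedHomogeneous wZ (br K h h') ({h} + {h'}) := by
  refine IsWeightedHomogeneous.add ?_ ?_
  · exact (isWeightedHomogeneous_X K wZ (h, 0)).mul (isWeightedHomogeneous_X K wZ (h', 1))
  · exact (isWeightedHomogeneous_X K wZ (h, 1)).mul (isWeightedHomogeneous_X K wZ (h', 0))

lemma BP_wh (L : Multiset (H × H)) : IsWeightedHomogeneous wZ (BP K L) (entries L) := by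
  induction L using Multiset.induction_on with
  | empty => simpa [BP, entries] using isWeightedHomogeneous_one K (wZ : H × Fin 2 → _)
  | cons p L ih =>
    rw [BP_cons]
    have := (br_wh (K := K) p.1 p.2).mul ih
    rwa [show entries (p ::ₘ L) = {p.1} + {p.2} + entries L by simp [entries]]

lemma actZ_X (g : V → Matrix (Fin 2) (Fin 2) K) (h : H) (i : Fin 2) :
    actZ K vert g (X (h, i)) = C (g (vert h) i 0) * X (h, 0) + C (g (vert h) i 1) * X (h, 1) := by
  simp [actZ, Fin.sum_univ_two]

lemma two_zero [CharP K 2] {σ : Type*} : (2 : MvPolynomial σ K) = 0 := by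
  have : (2 : K) = 0 := by exact_mod_cast CharP.cast_eq_zero K 2
  calc (2 : MvPolynomial σ K) = C 2 := (map_ofNat C 2).symm
    _ = 0 := by rw [this, map_zero]

lemma actZ_br [CharP K 2] (g : V → Matrix (Fin 2) (Fin 2) K) (hg : ∀ v, (g v).det = 1) (h h' : H)
    (hv : vert h = vert h') : actZ K vert g (br K h h') = br K h h' := by
  unfold br
  simp only [map_add, map_mul, actZ_X, ← hv]
  have hd := hg (vert h)
  rw [Matrix.det_fin_two] at hd
  have hd' := congrArg (C (σ := H × Fin 2)) hd
  simp only [map_sub, map_mul, map_one] at hd'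
  have h2 := two_zero (K := K) (σ := H × Fin 2)
  linear_combination (X (h, 0) * X (h', 1) + X (h, 1) * X (h', 0)) * hd' +
    (C (g (vert h) 0 0) * C (g (vert h) 1 0) * X (h, 0) * X (h', 0)
     + C (g (vert h) 0 1) * C (g (vert h) 1 1) * X (h, 1) * X (h', 1)
     + C (g (vert h) 0 1) * C (g (vert h) 1 0) * (X (h, 0) * X (h', 1) + X (h, 1) * X (h', 0))) * h2

lemma actZ_BP [CharP K 2] (g : V → Matrix (Fin 2) (Fin 2) K) (hg : ∀ v, (g v).det = 1)
    (L : Multiset (H × H)) (hL : ∀ p ∈ L, vert p.1 = vert p.2) :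
    actZ K vert g (BP K L) = BP K L := by
  induction L using Multiset.induction_on with
  | empty => simp [BP]
  | cons p L ih =>
    rw [BP_cons, map_mul, actZ_br g hg _ _ (hL p (by simp)), ih fun q hq => hL q (by simp [hq])]

lemma br_ne_zero {h h' : H} (hne : h ≠ h') : br K h h' ≠ 0 := by
  intro h0
  have := congrArg (eval (fun p : H × Fin 2 => if p = (h, 0) ∨ p = (h', 1) then (1 : K) else 0)) h0
  simp [br, hne, hne.symm] at this

lemma lift_entries (t : H → H) (L : Multiset (H × H)) : ∀ R : Multiset H, entries L = R.map t →
    ∃ L' : Multiset (H × H), L'.map (Prod.map t t) = L ∧ entries L' = R := by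
  induction L using Multiset.induction_on with
  | empty =>
    intro R hR
    rw [entries_zero] at hR
    have : R = 0 := Multiset.map_eq_zero.1 hR.symm
    exact ⟨0, by simp, by rw [this, entries_zero]⟩
  | cons p L ih =>
    intro R hR
    rw [entries_cons] at hR
    obtain ⟨x, hx, hxp⟩ := Multiset.mem_map.1 (show p.1 ∈ R.map t by rw [← hR]; simp)
    obtain ⟨R1, rfl⟩ := Multiset.exists_cons_of_mem hx
    rw [Multiset.map_cons, hxp, Multiset.cons_inj_right] at hR
    obtain ⟨y, hy, hyp⟩ := Multiset.mem_map.1 (show p.2 ∈ R1.map t by rw [← hR]; simp)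
    obtain ⟨R2, rfl⟩ := Multiset.exists_cons_of_mem hy
    rw [Multiset.map_cons, hyp, Multiset.cons_inj_right] at hR
    obtain ⟨L', h1, h2⟩ := ih R2 hR
    refine ⟨(x, y) ::ₘ L', ?_, ?_⟩
    · rw [Multiset.map_cons, h1]; simp [Prod.map, hxp, hyp]
    · rw [entries_cons, h2]

variable [Fintype H]

lemma weight_count (s : H × Fin 2 →₀ ℕ) (h : H) :
    (Finsupp.weight wZ s).count h = s (h, 0) + s (h, 1) := by
  rw [Finsupp.weight_apply, Finsupp.sum_fintype _ _ (by simp), Multiset.count_sum']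
  simp only [wZ, Multiset.count_nsmul, Multiset.count_singleton, Fintype.sum_prod_type,
    Fin.sum_univ_two]
  simp [Finset.sum_add_distrib]

lemma mapDomain_count (t : H → H) (s : H × Fin 2 →₀ ℕ) (h : H) (i : Fin 2) :
    s.mapDomain (Prod.map t id) (h, i) = ∑ x, if t x = h then s (x, i) else 0 := by
  rw [Finsupp.mapDomain, Finsupp.sum_apply, Finsupp.sum_fintype _ _ (by simp)]
  simp only [Fintype.sum_prod_type, Finsupp.single_apply, Prod.map, Prod.mk.injEq, id]
  refine Finset.sum_congr rfl fun x _ => ?_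
  fin_cases i <;> simp [Fin.sum_univ_two]

lemma monomial_split (s : H × Fin 2 →₀ ℕ) {h h' : H} (hne : h ≠ h') :
    (monomial s (1 : K)) = (X (h, 0) ^ s (h, 0) * X (h, 1) ^ s (h, 1) * X (h', 0) ^ s (h', 0) *
      X (h', 1) ^ s (h', 1)) *
      ∏ x ∈ (Finset.univ.erase h).erase h', (X (x, 0) ^ s (x, 0) * X (x, 1) ^ s (x, 1)) := by
  rw [monomial_eq, map_one, one_mul, Finsupp.prod_fintype _ _ (by simp), Fintype.prod_prod_type]
  simp only [Fin.prod_univ_two]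
  rw [← Finset.mul_prod_erase Finset.univ _ (Finset.mem_univ h),
    ← Finset.mul_prod_erase (Finset.univ.erase h) _
      (Finset.mem_erase.2 ⟨hne.symm, Finset.mem_univ h'⟩)]
  ring

lemma merge_aux {S : Type*} [CommRing S] {h h' : H} (hne : h ≠ h') (φ : MvPolynomial (H × Fin 2) K →+* S)
    (hφ : φ (X (h, 0)) * φ (X (h', 1)) = φ (X (h, 1)) * φ (X (h', 0))) (s s' : H × Fin 2 →₀ ℕ)
    (hw : Finsupp.weight wZ s = Finsupp.weight wZ s')
    (hss : s.mapDomain (Prod.map (fun x => if x = h' then h else x) (id : Fin 2 → Fin 2)) =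
      s'.mapDomain (Prod.map (fun x => if x = h' then h else x) (id : Fin 2 → Fin 2))) :
    φ (monomial s 1) = φ (monomial s' 1) := by
  have hrow : ∀ x, s (x, 0) + s (x, 1) = s' (x, 0) + s' (x, 1) := by
    intro x
    rw [← weight_count, ← weight_count, hw]
  have hcol : ∀ x i, (∑ y, if (if y = h' then h else y) = x then s (y, i) else 0) =
      ∑ y, if (if y = h' then h else y) = x then s' (y, i) else 0 := by
    intro x i
    rw [← mapDomain_count (fun y => if y = h' then h else y),
      ← mapDomain_count (fun y => if y = h' then h else y), hss]
  have hoff : ∀ x, x ≠ h → x ≠ h' → ∀ i, s (x, i) = s' (x, i) := by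
    intro x hx hx' i
    have := hcol x i
    have e : ∀ u : H × Fin 2 →₀ ℕ, (∑ y, if (if y = h' then h else y) = x then u (y, i) else 0) = u (x, i) := by
      intro u
      rw [Finset.sum_eq_single x]
      · simp [hx']
      · intro y _ hy
        rw [if_neg]
        split_ifs
        · exact hx.symm
        · exact hy
      · simp
    rwa [e, e] at this
  have hon : ∀ i, s (h, i) + s (h', i) = s' (h, i) + s' (h', i) := by
    intro i
    have := hcol h i
    have e : ∀ u : H × Fin 2 →₀ ℕ, (∑ y, if (if y = h' then h else y) = h then u (y, i) else 0) =
        u (h, i) + u (h', i) := by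
      intro u
      rw [← Finset.add_sum_erase Finset.univ _ (Finset.mem_univ h),
        ← Finset.add_sum_erase (Finset.univ.erase h) _
          (Finset.mem_erase.2 ⟨hne.symm, Finset.mem_univ h'⟩), Finset.sum_eq_zero]
      · simp [hne]
      · intro y hy
        simp only [Finset.mem_erase, Finset.mem_univ, and_true] at hy
        simp [hy.1, hy.2]
    rwa [e, e] at this
  rw [monomial_split s hne, monomial_split s' hne]
  refine (map_mul φ _ _).trans (Eq.trans ?_ (map_mul φ _ _).symm)
  refine congrArg₂ (· * ·) ?_ ?_
  · simp only [map_mul, map_pow]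
    exact rowcol hφ (hrow h) (hrow h') (hon 0)
  · congr 1
    refine Finset.prod_congr rfl fun x hx => ?_
    simp only [Finset.mem_erase, Finset.mem_univ, and_true] at hx
    rw [hoff x hx.2 hx.1, hoff x hx.2 hx.1]

lemma ker_merge [CharP K 2] {h h' : H} (hne : h ≠ h') {R : Multiset H} {f : MvPolynomial (H × Fin 2) K}
    (hf : IsWeightedHomogeneous wZ f R)
    (h0 : rename (Prod.map (fun x => if x = h' then h else x) (id : Fin 2 → Fin 2)) f = 0) :
    br K h h' ∣ f := by
  rw [← Ideal.mem_span_singleton]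
  refine ker_monomial (rename (Prod.map (fun x => if x = h' then h else x) (id : Fin 2 → Fin 2)) :
    MvPolynomial (H × Fin 2) K →ₐ[K] MvPolynomial (H × Fin 2) K).toLinearMap
    (fun s => s.mapDomain (Prod.map (fun x => if x = h' then h else x) id))
    (fun s => rename_monomial _ _ _) ((Ideal.span {br K h h'}).restrictScalars K) f ?_ h0
  intro s hs s' hs' hss
  have hw := hf (mem_support_iff.1 hs)
  have hw' := hf (mem_support_iff.1 hs')
  have key := merge_aux hne (Ideal.Quotient.mk (Ideal.span {br K h h'})) ?_ s s' (hw.trans hw'.symm) hss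
  · exact Ideal.Quotient.eq.1 key
  · rw [← map_mul, ← map_mul, Ideal.Quotient.eq, Ideal.mem_span_singleton]
    refine ⟨1, ?_⟩
    unfold br
    linear_combination (-X (h, 1) * X (h', 0)) * two_zero (K := K) (σ := H × Fin 2)

lemma exists_pow_ne_one [Infinite K] (r : ℕ) (hr : 0 < r) : ∃ l : K, l ≠ 0 ∧ l ^ r ≠ 1 := by
  by_contra hc
  push Not at hc
  have h0 : (Polynomial.X * (Polynomial.X ^ r - 1) : Polynomial K) = 0 := by
    refine Polynomial.funext fun l => ?_
    by_cases hl : l = 0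
    · simp [hl]
    · simp [hc l hl]
  rcases mul_eq_zero.1 h0 with h | h
  · exact Polynomial.X_ne_zero h
  · exact (Polynomial.X_pow_sub_C_ne_zero hr (1 : K)) (by simpa using h)

lemma actZ_eval (g : V → Matrix (Fin 2) (Fin 2) K) (z : H × Fin 2 → K) (f : MvPolynomial (H × Fin 2) K) :
    eval z (actZ K vert g f) =
      eval (fun p => g (vert p.1) p.2 0 * z (p.1, 0) + g (vert p.1) p.2 1 * z (p.1, 1)) f := by
  rw [← coe_aeval_eq_eval, ← coe_aeval_eq_eval, actZ]
  change ((aeval z).comp (aeval _)) f = _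
  rw [comp_aeval]
  simp [Fin.sum_univ_two]

lemma fft_zero [Infinite K] {R : Multiset H} {f : MvPolynomial (H × Fin 2) K}
    (hf : IsWeightedHomogeneous wZ f R) (hinv : SLinv K vert f) {h : H} (hh : h ∈ R)
    (hd : ∀ x ∈ R, x ≠ h → vert x ≠ vert h) : f = 0 := by
  have hX : (X (h, 0) : MvPolynomial (H × Fin 2) K) * f = 0 := by
    refine MvPolynomial.funext fun z => ?_
    rw [map_mul, eval_X, map_zero]
    by_cases hp : z (h, 0) = 0
    · rw [hp, zero_mul]
    rw [mul_eq_zero]; right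
    -- reduce to support in R
    have h1 := wh_scale_eval (fun S : Multiset H => if ∀ x ∈ S, x ∈ R then (1 : K) else 0) (by simp)
      (by
        intro a b
        simp only [Multiset.mem_add]
        by_cases ha : ∀ x ∈ a, x ∈ R <;> by_cases hb : ∀ x ∈ b, x ∈ R
        · rw [if_pos, if_pos ha, if_pos hb, one_mul]
          rintro x (hx | hx)
          · exact ha x hx
          · exact hb x hx
        · rw [if_neg hb, mul_zero, if_neg]
          exact fun hc => hb fun x hx => hc x (Or.inr hx)
        · rw [if_neg ha, zero_mul, if_neg]
          exact fun hc => ha fun x hx => hc x (Or.inl hx)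
        · rw [if_neg hb, mul_zero, if_neg]
          exact fun hc => hb fun x hx => hc x (Or.inr hx)) hf z
    simp only [imp_self, implies_true, if_true, one_mul] at h1
    rw [← h1]
    set z0 : H × Fin 2 → K := fun i => (if ∀ x ∈ wZ i, x ∈ R then 1 else 0) * z i with hz0
    have hz0' : ∀ x i, z0 (x, i) = if x ∈ R then z (x, i) else 0 := by
      intro x i
      simp [hz0, wZ]
    obtain ⟨l, hl0, hl1⟩ := exists_pow_ne_one (K := K) (R.count h) (Multiset.count_pos.2 hh)
    let g : V → Matrix (Fin 2) (Fin 2) K := fun v => if v = vert h then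
      !![l, 0; (l - l⁻¹) * z (h, 1) / z (h, 0), l⁻¹] else 1
    have hg : ∀ v, (g v).det = 1 := by
      intro v
      simp only [g]
      split_ifs
      · simp [Matrix.det_fin_two, hl0]
      · simp
    have h2 := actZ_eval (vert := vert) g z0 f
    rw [hinv g hg] at h2
    have h3 : (fun p : H × Fin 2 => g (vert p.1) p.2 0 * z0 (p.1, 0) + g (vert p.1) p.2 1 * z0 (p.1, 1)) =
        fun p => l ^ (Multiset.count h (wZ p)) * z0 p := by
      funext ⟨x, i⟩
      simp only [hz0', wZ, Multiset.count_singleton]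
      by_cases hx : x ∈ R
      · by_cases hxh : x = h
        · subst hxh
          simp only [g, hx, if_true]
          fin_cases i
          · simp
          · simp
            field_simp
            ring
        · have := hd x hx hxh
          simp only [g, hx, if_true, if_neg this, if_neg (Ne.symm hxh)]
          fin_cases i <;> simp [Matrix.one_apply]
      · simp [hx]
    rw [h3, wh_scale_eval (fun S : Multiset H => l ^ S.count h) (by simp)
      (by intro a b; simp [pow_add]) hf z0] at h2
    have h4 : (l ^ R.count h - 1) * eval z0 f = 0 := by rw [sub_mul, ← h2]; ring
    rcases mul_eq_zero.1 h4 with h5 | h5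
    · exact absurd (sub_eq_zero.1 h5) hl1
    · exact h5
  rcases mul_eq_zero.1 hX with h5 | h5
  · exact absurd h5 (X_ne_zero _)
  · exact h5

variable (K vert) in
noncomputable def BSp (R : Multiset H) : Submodule K (MvPolynomial (H × Fin 2) K) :=
  Submodule.span K {x | ∃ L : Multiset (H × H), (∀ p ∈ L, vert p.1 = vert p.2) ∧ entries L = R ∧ x = BP K L}

lemma BSp_wh {R : Multiset H} {F : MvPolynomial (H × Fin 2) K} (hF : F ∈ BSp K vert R) :
    IsWeightedHomogeneous wZ F R := by
  rw [← mem_weightedHomogeneousSubmodule]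
  refine (Submodule.span_le.2 ?_) hF
  rintro x ⟨L, -, rfl, rfl⟩
  exact BP_wh L

lemma BSp_inv [CharP K 2] {R : Multiset H} {F : MvPolynomial (H × Fin 2) K} (hF : F ∈ BSp K vert R) :
    SLinv K vert F := by
  intro g hg
  unfold BSp at hF
  induction hF using Submodule.span_induction with
  | mem x hx =>
    obtain ⟨L, h1, -, rfl⟩ := hx
    exact actZ_BP g hg L h1
  | zero => simp
  | add x y _ _ hx hy => rw [map_add, hx, hy]
  | smul c x _ hx => rw [map_smul, hx]

lemma rename_actZ {t : H → H} (ht : ∀ x, vert (t x) = vert x) (g : V → Matrix (Fin 2) (Fin 2) K)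
    (f : MvPolynomial (H × Fin 2) K) :
    actZ K vert g (rename (Prod.map t (id : Fin 2 → Fin 2)) f) =
      rename (Prod.map t (id : Fin 2 → Fin 2)) (actZ K vert g f) := by
  refine DFunLike.congr_fun (F := MvPolynomial (H × Fin 2) K →ₐ[K] MvPolynomial (H × Fin 2) K)
    (f := (actZ K vert g).comp (rename (Prod.map t (id : Fin 2 → Fin 2))))
    (g := (rename (Prod.map t (id : Fin 2 → Fin 2))).comp (actZ K vert g))
    (MvPolynomial.algHom_ext fun p => ?_) f
  obtain ⟨x, i⟩ := p
  simp only [AlgHom.comp_apply, rename_X, Prod.map, id, actZ_X, ht, map_add, map_mul, rename_C]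

lemma fft [CharP K 2] [Infinite K] (n : ℕ) : ∀ (R : Multiset H) (f : MvPolynomial (H × Fin 2) K),
    Multiset.card R + R.toFinset.card ≤ n → IsWeightedHomogeneous wZ f R → SLinv K vert f →
    f ∈ BSp K vert R := by
  induction n using Nat.strong_induction_on with
  | _ n IH =>
  intro R f hn hf hinv
  rcases Multiset.empty_or_exists_mem R with rfl | ⟨h, hh⟩
  · -- constant
    have hc : f = C (coeff 0 f) := by
      ext d
      rw [coeff_C]
      split_ifs with hd
      · rw [hd]
      · by_contra hne
        apply hd
        have := hf hne
        ext ⟨x, i⟩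
        have hx := weight_count d x
        rw [this, Multiset.count_zero] at hx
        fin_cases i
        · simp; omega
        · simp; omega
    rw [hc, ← mul_one (C _), ← smul_eq_C_mul]
    refine Submodule.smul_mem _ _ (Submodule.subset_span ⟨0, by simp, entries_zero, by simp [BP]⟩)
  by_cases hd : ∀ x ∈ R, x ≠ h → vert x ≠ vert h
  · rw [fft_zero hf hinv hh hd]
    exact Submodule.zero_mem _
  push Not at hd
  obtain ⟨h', hh', hne, hv⟩ := hd
  set t : H → H := fun x => if x = h' then h else x with ht
  have hvt : ∀ x, vert (t x) = vert x := by
    intro x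
    simp only [ht]
    split_ifs with hx
    · rw [hx, hv]
    · rfl
  set π := (rename (Prod.map t (id : Fin 2 → Fin 2)) :
    MvPolynomial (H × Fin 2) K →ₐ[K] MvPolynomial (H × Fin 2) K) with hπ
  have hwπ : IsWeightedHomogeneous wZ (π f) (R.map t) := by
    refine wh_map (w := fun p => (Multiset.mapAddMonoidHom t) (wZ p)) π ?_
      (wh_theta (Multiset.mapAddMonoidHom t) hf)
    rintro ⟨x, i⟩
    rw [hπ, rename_X]
    simpa [wZ] using isWeightedHomogeneous_X K (wZ : H × Fin 2 → Multiset H) (t x, i)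
  have hlt : Multiset.card (R.map t) + (R.map t).toFinset.card < n := by
    rw [Multiset.card_map, Multiset.toFinset_map]
    have : (R.toFinset.image t).card < R.toFinset.card := by
      refine lt_of_le_of_ne Finset.card_image_le fun hc => ?_
      rw [Finset.card_image_iff] at hc
      refine hne (hc (by simpa using hh') (by simpa using hh) ?_)
      simp only [ht]
      simp [hne.symm]
    omega
  have hπf := IH _ hlt (R.map t) (π f) le_rfl hwπ (by
    intro g hg
    rw [hπ, rename_actZ hvt, hinv g hg])
  obtain ⟨F, hF, hFπ⟩ : ∃ F ∈ BSp K vert R, π F = π f := by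
    have : BSp K vert (R.map t) ≤ (BSp K vert R).map π.toLinearMap := by
      refine Submodule.span_le.2 ?_
      rintro x ⟨L, h1, h2, rfl⟩
      obtain ⟨L', h3, h4⟩ := lift_entries t L R h2
      refine ⟨BP K L', Submodule.subset_span ⟨L', ?_, h4, rfl⟩, ?_⟩
      · intro p hp
        have := h1 (Prod.map t t p) (by rw [← h3]; exact Multiset.mem_map_of_mem _ hp)
        simpa [hvt] using this
      · rw [← h3]
        simp only [AlgHom.toLinearMap_apply, BP, Multiset.map_map]
        rw [map_multiset_prod, Multiset.map_map]
        congr 1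
        refine Multiset.map_congr rfl fun p _ => ?_
        simp [br, hπ, rename_X]
    obtain ⟨F, hF, hF'⟩ := this hπf
    exact ⟨F, hF, hF'⟩
  have hw2 : IsWeightedHomogeneous wZ (f - F) R := by
    rw [← mem_weightedHomogeneousSubmodule]
    exact Submodule.sub_mem _ ((mem_weightedHomogeneousSubmodule _ _ _ _).2 hf)
      ((mem_weightedHomogeneousSubmodule _ _ _ _).2 (BSp_wh hF))
  obtain ⟨q, hq⟩ := ker_merge hne.symm hw2 (by
    change π (f - F) = 0
    rw [map_sub, hFπ, sub_self])
  obtain ⟨R1, rfl⟩ := Multiset.exists_cons_of_mem hh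
  obtain ⟨R2, rfl⟩ := Multiset.exists_cons_of_mem
    ((Multiset.mem_cons.1 hh').resolve_left hne)
  have hR : h ::ₘ h' ::ₘ R2 = ({h} + {h'}) + R2 := by
    simp [Multiset.singleton_add]
  have hq2 : f - F = br K h h' * weightedHomogeneousComponent wZ R2 q := by
    rw [← whc_mul (br_wh h h'), ← hq, ← hR, whc_self hw2]
  set q2 := weightedHomogeneousComponent wZ R2 q with hq2d
  have hq2w : IsWeightedHomogeneous wZ q2 R2 := weightedHomogeneousComponent_isWeightedHomogeneous _ _
  have hq2i : SLinv K vert q2 := by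
    intro g hg
    have h1 : actZ K vert g (f - F) = f - F := by rw [map_sub, hinv g hg, BSp_inv hF g hg]
    rw [hq2, map_mul, actZ_br g hg h h' hv.symm] at h1
    exact mul_left_cancel₀ (br_ne_zero hne.symm) h1
  have hsub : R2.toFinset.card ≤ (h ::ₘ h' ::ₘ R2).toFinset.card := by
    refine Finset.card_le_card ?_
    intro x hx
    simp only [Multiset.mem_toFinset, Multiset.mem_cons] at hx ⊢
    exact Or.inr (Or.inr hx)
  have hq2m := IH (Multiset.card R2 + R2.toFinset.card) (by
    rw [Multiset.card_cons, Multiset.card_cons] at hn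
    omega) R2 q2 le_rfl hq2w hq2i
  have hmul : br K h h' * q2 ∈ BSp K vert (h ::ₘ h' ::ₘ R2) := by
    have : BSp K vert R2 ≤ (BSp K vert (h ::ₘ h' ::ₘ R2)).comap (LinearMap.mulLeft K (br K h h')) := by
      refine Submodule.span_le.2 ?_
      rintro x ⟨L, h1, h2, rfl⟩
      refine Submodule.subset_span ⟨(h, h') ::ₘ L, ?_, ?_, ?_⟩
      · intro p hp
        rcases Multiset.mem_cons.1 hp with rfl | hp
        · exact hv.symm
        · exact h1 p hp
      · rw [entries_cons, h2]
      · rw [BP_cons]; rfl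
    exact this hq2m
  have : f = F + br K h h' * q2 := by rw [← hq2]; ring
  rw [this]
  exact Submodule.add_mem _ hF hmul

end FFT


namespace QuiverData

section Lift
open MvPolynomial
variable (Q : QuiverData) (K : Type) [Field K]

/-- the polynomial ring in the half-edge vectors. -/
abbrev ZR : Type := MvPolynomial (Q.HE × Fin 2) K

noncomputable def tm (p q : Q.HE) : Matrix (Fin 2) (Fin 2) (Q.ZR K) :=
  !![X (p, 0) * X (q, 1), X (p, 0) * X (q, 0); X (p, 1) * X (q, 1), X (p, 1) * X (q, 0)]

noncomputable def rho : MvPolynomial Q.Var K →ₐ[K] Q.ZR K :=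
  aeval fun x : Q.Var => Q.tm K (x.1, true) (x.1, false) x.2.1 x.2.2

lemma rho_X (a : Q.A) (i j : Fin 2) :
    Q.rho K (X (Q.vr a i j)) = Q.tm K (a, true) (a, false) i j := by
  rw [rho, aeval_X]
  rfl

lemma rho_gen (a : Q.A) :
    (Q.genMat K a).map (Q.rho K).toRingHom = Q.tm K (a, true) (a, false) := by
  refine Matrix.ext fun i j => ?_
  rw [Matrix.map_apply, genMat_apply]
  exact Q.rho_X K a i j

variable {Q K}

lemma neg_eq2 [CharP K 2] {σ : Type*} (x : MvPolynomial σ K) : -x = x := by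
  linear_combination (-x) * two_zero (K := K) (σ := σ)

lemma tm_adj [CharP K 2] (p q : Q.HE) : (Q.tm K p q).adjugate = Q.tm K q p := by
  rw [tm, tm, Matrix.adjugate_fin_two_of]
  simp only [neg_eq2]
  refine Matrix.ext fun i j => ?_
  fin_cases i <;> fin_cases j <;> simp [mul_comm]

lemma tm_mul (p q p' q' : Q.HE) :
    Q.tm K p q * Q.tm K p' q' = br K q p' • Q.tm K p q' := by
  rw [tm, tm, tm, Matrix.mul_fin_two]
  refine Matrix.ext fun i j => ?_
  fin_cases i <;> fin_cases j <;> simp [br] <;> ring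

lemma tm_tr (p q : Q.HE) : (Q.tm K p q).trace = br K p q := by
  simp [tm, Matrix.trace_fin_two, br]

lemma tm_det (p q : Q.HE) : (Q.tm K p q).det = 0 := by
  simp [tm, Matrix.det_fin_two]
  ring

lemma map_adj2 {R S : Type*} [CommRing R] [CommRing S] (φ : R →+* S)
    (M : Matrix (Fin 2) (Fin 2) R) : M.adjugate.map φ = (M.map φ).adjugate :=
  (RingHom.map_adjugate φ M)

lemma rho_let [CharP K 2] (h : Q.HE) :
    (Q.dlet K h).map (Q.rho K).toRingHom = Q.tm K h (Q.flp h) := by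
  obtain ⟨a, _ | _⟩ := h
  · simp only [dlet]
    rw [map_adj2, rho_gen, tm_adj]
    rfl
  · exact Q.rho_gen K a

variable (Q K)

/-- partial words -/
structure Tup where
  w : List Q.HE
  c : Q.ZR K
  p : Q.HE
  q : Q.HE
  path : Q.dbl.IsPathFrom (Q.vert q) (Q.vert p) w
  mat : (Q.dmat K w).map (Q.rho K).toRingHom = c • Q.tm K p q

variable {Q K}

/-- arrows used by a word -/
def arr (w : List Q.HE) : Multiset Q.A := ((w.map Prod.fst : List Q.A) : Multiset Q.A)

lemma arr_append (w u : List Q.HE) : arr (w ++ u) = arr w + arr u := by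
  simp [arr]

lemma arr_star (w : List Q.HE) : arr (Q.star w) = arr w := by
  have : (Q.star w).map Prod.fst = (w.map Prod.fst).reverse := by
    simp [star, Function.comp_def]
  rw [arr, this, Multiset.coe_reverse]; rfl

noncomputable def Tup.star [CharP K 2] (t : Tup Q K) : Tup Q K where
  w := Q.star t.w
  c := t.c
  p := t.q
  q := t.p
  path := star_path t.path
  mat := by
    rw [dmat_star, map_adj2, t.mat, Matrix.adjugate_smul, tm_adj]
    simp

noncomputable def Tup.join (t s : Tup Q K) (h : Q.vert t.p = Q.vert s.q) : Tup Q K where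
  w := t.w ++ s.w
  c := t.c * s.c * br K s.q t.p
  p := s.p
  q := t.q
  path := by
    refine t.path.append ?_
    rw [h]
    exact s.path
  mat := by
    rw [dmat_append, Matrix.map_mul, t.mat, s.mat, Matrix.smul_mul, Matrix.mul_smul, tm_mul,
      smul_smul, smul_smul]
    congr 1
    ring

noncomputable def ent (C : Multiset (Tup Q K)) : Multiset Q.HE :=
  (C.map fun t => ({t.p} + {t.q} : Multiset Q.HE)).sum

lemma ent_cons (t : Tup Q K) (C : Multiset (Tup Q K)) : ent (t ::ₘ C) = t.p ::ₘ t.q ::ₘ ent C := by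
  simp [ent, Multiset.singleton_add]

lemma mem_bind_aux {α β : Type*} (F : α → Multiset β) (C : Multiset α) {h : β}
    (hh : h ∈ (C.map F).sum) : ∃ x ∈ C, h ∈ F x := by
  induction C using Multiset.induction_on with
  | empty => simp at hh
  | cons a C ih =>
    rw [Multiset.map_cons, Multiset.sum_cons, Multiset.mem_add] at hh
    rcases hh with hh | hh
    · exact ⟨a, by simp, hh⟩
    · obtain ⟨x, hx, hx'⟩ := ih hh
      exact ⟨x, by simp [hx], hx'⟩

lemma sum_map_sing {α β : Type*} (F : α → β) (C : Multiset α) :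
    (C.map fun a => ({F a} : Multiset β)).sum = C.map F := by
  induction C using Multiset.induction_on with
  | empty => simp
  | cons a C ih => rw [Multiset.map_cons, Multiset.sum_cons, ih, Multiset.map_cons, Multiset.singleton_add]

lemma exists_orient [CharP K 2] {C : Multiset (Tup Q K)} {h : Q.HE} (hh : h ∈ ent C) :
    ∃ t : Tup Q K, ∃ C' : Multiset (Tup Q K), t.p = h ∧ ent (t ::ₘ C') = ent C ∧
      Multiset.card (t ::ₘ C') = Multiset.card C ∧
      ((t ::ₘ C').map fun t => arr t.w).sum = (C.map fun t => arr t.w).sum ∧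
      ((t ::ₘ C').map fun t => t.c).prod = (C.map fun t => t.c).prod := by
  rw [ent] at hh
  obtain ⟨x, hx, hhx⟩ := mem_bind_aux (fun t : Tup Q K => ({t.p} + {t.q} : Multiset Q.HE)) C hh
  obtain ⟨C', rfl⟩ := Multiset.exists_cons_of_mem hx
  simp only [Multiset.mem_add, Multiset.mem_singleton] at hhx
  rcases hhx with rfl | rfl
  · exact ⟨x, C', rfl, rfl, rfl, rfl, rfl⟩
  · refine ⟨x.star, C', rfl, ?_, by simp, ?_, ?_⟩
    · rw [ent_cons, ent_cons]
      exact Multiset.cons_swap _ _ _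
    · simp only [Multiset.map_cons, Multiset.sum_cons]
      congr 1
      exact arr_star _
    · simp [Tup.star]

lemma rho_dtr (t : Tup Q K) : Q.rho K (Q.dtr K t.w) = t.c * br K t.p t.q := by
  have := map_trace2 (Q.rho K).toRingHom (Q.dmat K t.w)
  rw [t.mat, Matrix.trace_smul, tm_tr, smul_eq_mul] at this
  exact this

lemma lift_words [CharP K 2] (n : ℕ) : ∀ (C : Multiset (Tup Q K)) (L : Multiset (Q.HE × Q.HE)),
    Multiset.card C = n → (∀ p ∈ L, Q.vert p.1 = Q.vert p.2) → entries L = ent C →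
    ∃ Ws : Multiset (List Q.HE), Q.AllClosed Ws ∧
      (Ws.map arr).sum = (C.map fun t => arr t.w).sum ∧
      (Ws.map fun W => Q.rho K (Q.dtr K W)).prod = BP K L * (C.map fun t => t.c).prod := by
  induction n with
  | zero =>
    intro C L hC hL hE
    have hC0 := Multiset.card_eq_zero.1 hC
    subst hC0
    rcases Multiset.empty_or_exists_mem L with rfl | ⟨p, hp⟩
    · exact ⟨0, by simp [AllClosed], by simp, by simp [BP]⟩
    · obtain ⟨L', rfl⟩ := Multiset.exists_cons_of_mem hp
      rw [entries_cons] at hE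
      simp [ent] at hE
  | succ n ih =>
    intro C L hC hL hE
    rcases Multiset.empty_or_exists_mem L with rfl | ⟨⟨h, h'⟩, hp⟩
    · exfalso
      obtain ⟨t, ht⟩ := Multiset.card_pos_iff_exists_mem.1 (by omega : 0 < Multiset.card C)
      obtain ⟨C', rfl⟩ := Multiset.exists_cons_of_mem ht
      rw [ent_cons, entries_zero] at hE
      exact Multiset.zero_ne_cons hE
    obtain ⟨L, rfl⟩ := Multiset.exists_cons_of_mem hp
    have hv : Q.vert h = Q.vert h' := hL (h, h') (by simp)
    have hL' : ∀ p ∈ L, Q.vert p.1 = Q.vert p.2 := fun p hp => hL p (by simp [hp])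
    rw [entries_cons] at hE
    simp only at hE
    obtain ⟨t, C1, htp, hent, hcard, harr, hprod⟩ := exists_orient (C := C) (h := h)
      (by rw [← hE]; simp)
    rw [← hent, ent_cons, htp, Multiset.cons_inj_right] at hE
    rw [hC, Multiset.card_cons] at hcard
    rw [← harr, ← hprod]
    by_cases hq : t.q = h'
    · rw [hq, Multiset.cons_inj_right] at hE
      obtain ⟨Ws, h1, h2, h3⟩ := ih C1 L (by omega) hL' hE
      refine ⟨t.w ::ₘ Ws, ?_, ?_, ?_⟩
      · intro W hW
        rcases Multiset.mem_cons.1 hW with rfl | hW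
        · refine ⟨Q.vert h, ?_⟩
          have := t.path
          rwa [hq, htp, ← hv] at this
        · exact h1 W hW
      · simp [h2]
      · simp only [Multiset.map_cons, Multiset.prod_cons, h3, rho_dtr, BP_cons, htp, hq]
        ring
    · have hm : h' ∈ ent C1 := by
        have : h' ∈ t.q ::ₘ ent C1 := by rw [← hE]; simp
        exact (Multiset.mem_cons.1 this).resolve_left (Ne.symm hq)
      obtain ⟨s0, C2, hsp, hent2, hcard2, harr2, hprod2⟩ := exists_orient hm
      have hj : Q.vert t.p = Q.vert s0.star.q := by
        change _ = Q.vert s0.p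
        rw [htp, hsp, hv]
      have hE2 : entries L = ent (t.join s0.star hj ::ₘ C2) := by
        rw [← hent2, ent_cons, hsp, Multiset.cons_swap, Multiset.cons_inj_right] at hE
        rw [ent_cons, hE]
        exact Multiset.cons_swap _ _ _
      obtain ⟨Ws, h1, h2, h3⟩ := ih (t.join s0.star hj ::ₘ C2) L (by
        rw [Multiset.card_cons] at hcard2 ⊢; omega) hL' hE2
      refine ⟨Ws, h1, ?_, ?_⟩
      · rw [h2, Multiset.map_cons, Multiset.sum_cons, Multiset.map_cons, Multiset.sum_cons, ← harr2,
          Multiset.map_cons, Multiset.sum_cons, ← add_assoc]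
        congr 1
        change arr (t.w ++ Q.star s0.w) = _
        rw [arr_append, arr_star]
      · rw [h3, Multiset.map_cons, Multiset.prod_cons, Multiset.map_cons, Multiset.prod_cons, ← hprod2,
          Multiset.map_cons, Multiset.prod_cons, BP_cons]
        have : (t.join s0.star hj).c = t.c * s0.c * br K h' h := by
          change t.c * s0.c * br K s0.p t.p = _
          rw [hsp, htp]
        rw [this, br_comm h' h]
        ring

lemma lift_BP [CharP K 2] (E : Multiset Q.A) (L : Multiset (Q.HE × Q.HE))
    (hL : ∀ p ∈ L, Q.vert p.1 = Q.vert p.2)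
    (hE : entries L = E.map (fun a => (a, true)) + E.map (fun a => (a, false))) :
    ∃ Ws : Multiset (List Q.HE), Q.AllClosed Ws ∧ (Ws.map arr).sum = E ∧
      Q.rho K (Ws.map (Q.dtr K)).prod = BP K L := by
  let T0 : Q.A → Tup Q K := fun a =>
    { w := [(a, true)], c := 1, p := (a, true), q := (a, false), path := ⟨rfl, rfl⟩
      mat := by
        rw [one_smul, dmat, mprod_cons, mprod_nil, Matrix.one_mul]
        exact rho_let (a, true) }
  obtain ⟨Ws, h1, h2, h3⟩ := lift_words _ (E.map T0) L rfl hL (by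
    rw [hE, ent, Multiset.map_map]
    change _ = (E.map fun a => ({(a, true)} + {(a, false)} : Multiset Q.HE)).sum
    rw [Multiset.sum_map_add, sum_map_sing, sum_map_sing])
  refine ⟨Ws, h1, ?_, ?_⟩
  · rw [h2, Multiset.map_map]
    change (E.map fun a => ({a} : Multiset Q.A)).sum = E
    simp
  · rw [map_multiset_prod, Multiset.map_map]
    refine h3.trans ?_
    rw [Multiset.map_map]
    change _ * (E.map fun _ => (1 : Q.ZR K)).prod = _
    simp

/-- intertwining -/
lemma rho_act [CharP K 2] (g : Q.V → Matrix (Fin 2) (Fin 2) K) (hg : ∀ v, (g v).det = 1)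
    (f : MvPolynomial Q.Var K) :
    Q.rho K (aeval (Q.actVar K g) f) = actZ K Q.vert g (Q.rho K f) := by
  refine DFunLike.congr_fun (F := MvPolynomial Q.Var K →ₐ[K] Q.ZR K)
    (f := (Q.rho K).comp (aeval (Q.actVar K g))) (g := (actZ K Q.vert g).comp (Q.rho K))
    (MvPolynomial.algHom_ext fun p => ?_) f
  obtain ⟨a, i, j⟩ := p
  change Q.rho K (aeval (Q.actVar K g) (X (Q.vr a i j))) = actZ K Q.vert g (Q.rho K (X (Q.vr a i j)))
  rw [aeval_X, actVar_vr, rho_X]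
  have hinv : (g (Q.src a))⁻¹ = (g (Q.src a)).adjugate := by
    rw [Matrix.inv_def, hg]; simp
  rw [hinv, Matrix.adjugate_fin_two]
  simp only [Fin.sum_univ_two, map_add, map_mul, rho_X]
  have hC : ∀ c : K, Q.rho K (C c) = C c := fun c => by
    rw [← algebraMap_eq, AlgHom.commutes, algebraMap_eq]
  simp only [hC]
  have h1 : Q.vert (a, true) = Q.tgt a := rfl
  have h2 : Q.vert (a, false) = Q.src a := rfl
  fin_cases i <;> fin_cases j <;>
    (simp [tm, actZ_X, h1, h2, neg_eq2]; ring)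

end Lift
end QuiverData


namespace QuiverData

section Phase1
open MvPolynomial
set_option linter.unusedSectionVars false
variable (Q : QuiverData) (K : Type) [Field K]

def wA (p : Q.Var) : Multiset Q.A := {p.1}

noncomputable def GSp (E : Multiset Q.A) : Submodule K (MvPolynomial Q.Var K) :=
  Submodule.span K {x | ∃ (e : Multiset Q.A) (Ws : Multiset (List Q.HE)), Q.AllClosed Ws ∧
    e + e + (Ws.map arr).sum = E ∧ x = Q.GP K e Ws}

noncomputable def IB (B : Finset Q.A) : Ideal (MvPolynomial Q.Var K) :=
  Ideal.span ((fun b => (Q.genMat K b).det) '' (B : Set Q.A))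

noncomputable abbrev act (g : Q.V → Matrix (Fin 2) (Fin 2) K) :
    MvPolynomial Q.Var K →ₐ[K] MvPolynomial Q.Var K := aeval (Q.actVar K g)

variable {Q K}

/-! homogeneity -/

lemma gen_wh (a : Q.A) (i j : Fin 2) : IsWeightedHomogeneous Q.wA (Q.genMat K a i j) {a} :=
  isWeightedHomogeneous_X K Q.wA (Q.vr a i j)

lemma wh_neg {σ M : Type*} [AddCommMonoid M] {w : σ → M} {f : MvPolynomial σ K} {n : M}
    (h : IsWeightedHomogeneous w f n) : IsWeightedHomogeneous w (-f) n := by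
  rw [← mem_weightedHomogeneousSubmodule] at h ⊢
  exact Submodule.neg_mem _ h

lemma wh_sub {σ M : Type*} [AddCommMonoid M] {w : σ → M} {f g : MvPolynomial σ K} {n : M}
    (h : IsWeightedHomogeneous w f n) (h' : IsWeightedHomogeneous w g n) :
    IsWeightedHomogeneous w (f - g) n := by
  rw [← mem_weightedHomogeneousSubmodule] at h h' ⊢
  exact Submodule.sub_mem _ h h'

lemma let_wh (h : Q.HE) (i j : Fin 2) : IsWeightedHomogeneous Q.wA (Q.dlet K h i j) {h.1} := by
  obtain ⟨a, _ | _⟩ := h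
  · simp only [dlet]
    rw [Matrix.adjugate_fin_two]
    fin_cases i <;> fin_cases j
    · exact gen_wh a 1 1
    · exact wh_neg (gen_wh a 0 1)
    · exact wh_neg (gen_wh a 1 0)
    · exact gen_wh a 0 0
  · exact gen_wh a i j

lemma dmat_wh (W : List Q.HE) (i j : Fin 2) :
    IsWeightedHomogeneous Q.wA (Q.dmat K W i j) (arr W) := by
  induction W generalizing i j with
  | nil =>
    change IsWeightedHomogeneous Q.wA ((1 : Matrix (Fin 2) (Fin 2) (MvPolynomial Q.Var K)) i j) 0
    rw [Matrix.one_apply]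
    split_ifs
    · exact isWeightedHomogeneous_one K _
    · exact isWeightedHomogeneous_zero K _ _
  | cons h W ih =>
    have e : Q.dmat K (h :: W) = Q.dmat K W * Q.dlet K h := mprod_cons _ _ _
    rw [e, Matrix.mul_apply, Fin.sum_univ_two]
    have e2 : arr (h :: W) = arr W + {h.1} := by
      rw [show h :: W = [h] ++ W from rfl, arr_append, add_comm]; rfl
    rw [e2]
    exact ((ih i 0).mul (let_wh h 0 j)).add ((ih i 1).mul (let_wh h 1 j))

lemma dtr_wh (W : List Q.HE) : IsWeightedHomogeneous Q.wA (Q.dtr K W) (arr W) := by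
  rw [dtr, Matrix.trace_fin_two]
  exact (dmat_wh W 0 0).add (dmat_wh W 1 1)

lemma det_wh (a : Q.A) : IsWeightedHomogeneous Q.wA (Q.genMat K a).det ({a} + {a}) := by
  rw [Matrix.det_fin_two]
  exact wh_sub ((gen_wh a 0 0).mul (gen_wh a 1 1)) ((gen_wh a 0 1).mul (gen_wh a 1 0))

lemma GP_wh (e : Multiset Q.A) (Ws : Multiset (List Q.HE)) :
    IsWeightedHomogeneous Q.wA (Q.GP K e Ws) (e + e + (Ws.map arr).sum) := by
  refine IsWeightedHomogeneous.mul ?_ ?_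
  · induction e using Multiset.induction_on with
    | empty => simpa using isWeightedHomogeneous_one K Q.wA
    | cons a e ih =>
      rw [Multiset.map_cons, Multiset.prod_cons]
      have : (a ::ₘ e) + (a ::ₘ e) = ({a} + {a}) + (e + e) := by
        rw [← Multiset.singleton_add]; abel
      rw [this]
      exact (det_wh a).mul ih
  · induction Ws using Multiset.induction_on with
    | empty => simpa using isWeightedHomogeneous_one K Q.wA
    | cons W Ws ih =>
      rw [Multiset.map_cons, Multiset.prod_cons, Multiset.map_cons, Multiset.sum_cons]
      exact (dtr_wh W).mul ih

lemma GSp_wh {E : Multiset Q.A} {F : MvPolynomial Q.Var K} (hF : F ∈ Q.GSp K E) :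
    IsWeightedHomogeneous Q.wA F E := by
  rw [← mem_weightedHomogeneousSubmodule]
  refine (Submodule.span_le.2 ?_) hF
  rintro x ⟨e, Ws, -, rfl, rfl⟩
  exact GP_wh e Ws

/-! invariance -/

lemma inv_adj {g : Matrix (Fin 2) (Fin 2) K} (hg : g.det = 1) : g⁻¹ = g.adjugate := by
  rw [Matrix.inv_def, hg]; simp

lemma let_act (g : Q.V → Matrix (Fin 2) (Fin 2) K) (hg : ∀ v, (g v).det = 1) (h : Q.HE) :
    (Q.dlet K h).map (Q.act K g).toRingHom =
      (g (Q.vert h)).map C * Q.dlet K h * ((g (Q.vert (Q.flp h)))⁻¹).map C := by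
  obtain ⟨a, _ | _⟩ := h
  · change ((Q.genMat K a).adjugate).map (Q.act K g).toRingHom = (g (Q.src a)).map C *
      (Q.genMat K a).adjugate * ((g (Q.tgt a))⁻¹).map C
    rw [map_adj2]
    have := Q.genMat_act K g a
    rw [this, Matrix.adjugate_mul_distrib, Matrix.adjugate_mul_distrib, ← map_adj2, ← map_adj2,
      inv_adj (hg _), inv_adj (hg _), adj_adj, Matrix.mul_assoc]
  · exact Q.genMat_act K g a

lemma dtr_act (g : Q.V → Matrix (Fin 2) (Fin 2) K) (hg : ∀ v, (g v).det = 1) {v : Q.V}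
    {W : List Q.HE} (hW : Q.dbl.IsPathFrom v v W) : Q.act K g (Q.dtr K W) = Q.dtr K W := by
  have h1 := map_trace2 (Q.act K g).toRingHom (Q.dmat K W)
  rw [dmat, map_mprod] at h1
  refine h1.trans ?_
  exact mprod_conj_trace (Q := Q.dbl) (Q.dlet K) _ (fun v => (g v).map C)
    (fun v => ((g v)⁻¹).map C) (Q.pathMat_conj K g fun v => by rw [hg]; exact isUnit_one)
    (fun h => let_act g hg h) hW

lemma det_act (g : Q.V → Matrix (Fin 2) (Fin 2) K) (hg : ∀ v, (g v).det = 1) (a : Q.A) :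
    Q.act K g (Q.genMat K a).det = (Q.genMat K a).det := by
  have h1 := map_det2 (Q.act K g).toRingHom (Q.genMat K a)
  refine h1.trans ?_
  have h2 := Q.genMat_act K g a
  rw [h2, Matrix.det_mul, Matrix.det_mul, ← map_det2, ← map_det2, hg, inv_adj (hg _),
    Matrix.det_adjugate, hg]
  simp

lemma GSp_act {E : Multiset Q.A} {F : MvPolynomial Q.Var K} (hF : F ∈ Q.GSp K E)
    (g : Q.V → Matrix (Fin 2) (Fin 2) K) (hg : ∀ v, (g v).det = 1) : Q.act K g F = F := by
  unfold GSp at hF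
  induction hF using Submodule.span_induction with
  | mem x hx =>
    obtain ⟨e, Ws, hc, -, rfl⟩ := hx
    rw [GP, map_mul, map_multiset_prod, map_multiset_prod, Multiset.map_map, Multiset.map_map]
    congr 2
    · exact Multiset.map_congr rfl fun a _ => det_act g hg a
    · refine Multiset.map_congr rfl fun W hW => ?_
      obtain ⟨v, hv⟩ := hc W hW
      exact dtr_act g hg hv
  | zero => simp
  | add x y _ _ hx hy => rw [map_add, hx, hy]
  | smul c x _ hx => rw [map_smul, hx]

/-! ideals -/

lemma IB_mono {B B' : Finset Q.A} (h : B ⊆ B') : Q.IB K B ≤ Q.IB K B' :=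
  Ideal.span_mono (Set.image_mono (by exact_mod_cast h))

lemma IB_act (B : Finset Q.A) (g : Q.V → Matrix (Fin 2) (Fin 2) K) (hg : ∀ v, (g v).det = 1)
    {f : MvPolynomial Q.Var K} (hf : f ∈ Q.IB K B) : Q.act K g f ∈ Q.IB K B := by
  have : Q.IB K B ≤ (Q.IB K B).comap (Q.act K g) := by
    refine Ideal.span_le.2 ?_
    rintro x ⟨b, hb, rfl⟩
    change Q.act K g (Q.genMat K b).det ∈ Q.IB K B
    rw [det_act g hg]
    exact Ideal.subset_span ⟨b, hb, rfl⟩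
  exact this hf

lemma IB_whc (B : Finset Q.A) (E : Multiset Q.A) {f : MvPolynomial Q.Var K} (hf : f ∈ Q.IB K B) :
    weightedHomogeneousComponent Q.wA E f ∈ Q.IB K B := by
  have : ∀ r, weightedHomogeneousComponent Q.wA E (r * f) ∈ Q.IB K B := by
    unfold IB at hf
    induction hf using Submodule.span_induction with
    | mem x hx =>
      intro r
      obtain ⟨b, hb, rfl⟩ := hx
      change weightedHomogeneousComponent Q.wA E (r * (Q.genMat K b).det) ∈ _
      rw [mul_comm]
      by_cases hE : ∃ n, E = {b} + {b} + n
      · obtain ⟨n, rfl⟩ := hE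
        rw [whc_mul (det_wh b)]
        exact Ideal.mul_mem_right _ _ (Ideal.subset_span ⟨b, hb, rfl⟩)
      · push Not at hE
        rw [whc_mul_zero (det_wh b) _ _ hE]
        exact Ideal.zero_mem _
    | zero => intro r; simp
    | add x y _ _ hx hy =>
      intro r
      rw [mul_add, map_add]
      exact Ideal.add_mem _ (hx r) (hy r)
    | smul c x _ hx =>
      intro r
      rw [smul_eq_mul, ← mul_assoc]
      exact hx _
  simpa using this 1

/-! the map `rhoB` -/

variable (Q K)

noncomputable def mB (B : Finset Q.A) (x : Q.Var) : (Q.Var ⊕ (Q.HE × Fin 2)) →₀ ℕ :=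
  if x.1 ∈ B then
    Finsupp.single (Sum.inr ((x.1, true), x.2.1)) 1 + Finsupp.single (Sum.inr ((x.1, false), 1 - x.2.2)) 1
  else Finsupp.single (Sum.inl x) 1

noncomputable def rhoB (B : Finset Q.A) :
    MvPolynomial Q.Var K →ₐ[K] MvPolynomial (Q.Var ⊕ (Q.HE × Fin 2)) K :=
  aeval fun x => monomial (Q.mB B x) 1

variable {Q K}

lemma rhoB_monomial (B : Finset Q.A) (s : Q.Var →₀ ℕ) :
    Q.rhoB K B (monomial s 1) = monomial (Finsupp.weight (Q.mB B) s) 1 := by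
  rw [rhoB, aeval_monomial, map_one, one_mul, Finsupp.weight_apply, Finsupp.sum, Finsupp.prod,
    monomial_sum_one]
  refine Finset.prod_congr rfl fun x _ => ?_
  rw [monomial_pow, one_pow]

lemma mB_in {B : Finset Q.A} {a : Q.A} (ha : a ∈ B) (i j : Fin 2) : Q.mB B (Q.vr a i j) =
    Finsupp.single (Sum.inr ((a, true), i)) 1 + Finsupp.single (Sum.inr ((a, false), 1 - j)) 1 :=
  if_pos ha

lemma mB_out {B : Finset Q.A} {a : Q.A} (ha : a ∉ B) (i j : Fin 2) : Q.mB B (Q.vr a i j) =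
    Finsupp.single (Sum.inl (Q.vr a i j)) 1 := if_neg ha

lemma rhoB_in {B : Finset Q.A} {a : Q.A} (ha : a ∈ B) (i j : Fin 2) :
    Q.rhoB K B (X (Q.vr a i j)) = X (Sum.inr ((a, true), i)) * X (Sum.inr ((a, false), 1 - j)) := by
  rw [rhoB, aeval_X, mB_in ha, ← mul_one (1 : K), ← monomial_mul]
  rfl

lemma rhoB_out {B : Finset Q.A} {a : Q.A} (ha : a ∉ B) (i j : Fin 2) :
    Q.rhoB K B (X (Q.vr a i j)) = X (Sum.inl (Q.vr a i j)) := by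
  rw [rhoB, aeval_X, mB_out ha]
  rfl

lemma rhoB_IB {B : Finset Q.A} {f : MvPolynomial Q.Var K} (hf : f ∈ Q.IB K B) : Q.rhoB K B f = 0 := by
  have : Q.IB K B ≤ RingHom.ker (Q.rhoB K B) := by
    refine Ideal.span_le.2 ?_
    rintro x ⟨b, hb, rfl⟩
    change Q.rhoB K B (Q.genMat K b).det = 0
    rw [Matrix.det_fin_two]
    simp only [genMat_apply, map_sub, map_mul, rhoB_in (Finset.mem_coe.1 hb)]
    ring
  exact this hf

variable [Fintype Q.A]

noncomputable instance instFintypeVar : Fintype Q.Var := inferInstanceAs (Fintype (Q.A × Fin 2 × Fin 2))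

lemma sum_Var {N : Type*} [AddCommMonoid N] (F : Q.Var → N) : ∑ x, F x =
    ∑ a, ((F (Q.vr a 0 0) + F (Q.vr a 0 1)) + (F (Q.vr a 1 0) + F (Q.vr a 1 1))) := by
  have key : ∀ G : Q.A × Fin 2 × Fin 2 → N, ∑ x, G x =
      ∑ a, ((G (a, 0, 0) + G (a, 0, 1)) + (G (a, 1, 0) + G (a, 1, 1))) := by
    intro G
    simp only [Fintype.sum_prod_type, Fin.sum_univ_two]
  exact key F

lemma prod_Var {N : Type*} [CommMonoid N] (F : Q.Var → N) : ∏ x, F x =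
    ∏ a, ((F (Q.vr a 0 0) * F (Q.vr a 0 1)) * (F (Q.vr a 1 0) * F (Q.vr a 1 1))) := by
  have key : ∀ G : Q.A × Fin 2 × Fin 2 → N, ∏ x, G x =
      ∏ a, ((G (a, 0, 0) * G (a, 0, 1)) * (G (a, 1, 0) * G (a, 1, 1))) := by
    intro G
    simp only [Fintype.prod_prod_type, Fin.prod_univ_two]
  exact key F

lemma weight_mB (B : Finset Q.A) (s : Q.Var →₀ ℕ) (y : Q.Var ⊕ (Q.HE × Fin 2)) (a : Q.A)
    (hy : ∀ b i j, b ≠ a → Q.mB B (Q.vr b i j) y = 0) :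
    Finsupp.weight (Q.mB B) s y =
      (s (Q.vr a 0 0) * Q.mB B (Q.vr a 0 0) y + s (Q.vr a 0 1) * Q.mB B (Q.vr a 0 1) y) +
      (s (Q.vr a 1 0) * Q.mB B (Q.vr a 1 0) y + s (Q.vr a 1 1) * Q.mB B (Q.vr a 1 1) y) := by
  rw [Finsupp.weight_apply, Finsupp.sum_fintype _ _ (by simp), sum_Var, Finsupp.finsetSum_apply,
    Finset.sum_eq_single a]
  · simp
  · intro b _ hb
    simp [hy b _ _ hb]
  · simp

lemma vr_ne {a b : Q.A} (h : b ≠ a) (i j i' j' : Fin 2) : Q.vr b i j ≠ Q.vr a i' j' :=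
  fun hc => h (congrArg Prod.fst hc)

lemma vr_inj {a : Q.A} {i j i' j' : Fin 2} : Q.vr a i j = Q.vr a i' j' ↔ i = i' ∧ j = j' := by
  constructor
  · intro h
    have := congrArg Prod.snd h
    exact Prod.mk.inj this
  · rintro ⟨rfl, rfl⟩; rfl

lemma mB_aux {S : Type*} [CommRing S] (B : Finset Q.A) (φ : MvPolynomial Q.Var K →+* S)
    (hφ : ∀ b ∈ B, φ (X (Q.vr b 0 0)) * φ (X (Q.vr b 1 1)) = φ (X (Q.vr b 0 1)) * φ (X (Q.vr b 1 0)))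
    (s s' : Q.Var →₀ ℕ) (hw : Finsupp.weight (Q.mB B) s = Finsupp.weight (Q.mB B) s') :
    φ (monomial s 1) = φ (monomial s' 1) := by
  rw [monomial_eq, monomial_eq, map_one, one_mul, one_mul, Finsupp.prod_fintype _ _ (by simp),
    Finsupp.prod_fintype _ _ (by simp), prod_Var, prod_Var, map_prod, map_prod]
  refine Finset.prod_congr rfl fun a _ => ?_
  simp only [map_mul, map_pow]
  by_cases ha : a ∈ B
  · have key : ∀ y, (∀ b i j, b ≠ a → Q.mB B (Q.vr b i j) y = 0) → _ := fun y hy =>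
      (weight_mB B s y a hy).symm.trans ((DFunLike.congr_fun hw y).trans (weight_mB B s' y a hy))
    have hz : ∀ (t : Bool) (k : Fin 2) b i j, b ≠ a → Q.mB B (Q.vr b i j) (Sum.inr ((a, t), k)) = 0 := by
      intro t k b i j hb
      by_cases hbB : b ∈ B
      · rw [mB_in hbB]; simp [Finsupp.single_apply, hb]
      · rw [mB_out hbB]; simp [Finsupp.single_apply]
    have k1 := key _ (hz true 0)
    have k2 := key _ (hz true 1)
    have k3 := key _ (hz false 1)
    simp [mB_in ha, Finsupp.single_apply] at k1 k2 k3
    have := rowcol (hφ a ha) k1 k2 k3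
    simp only [← mul_assoc]
    exact this
  · have key : ∀ i j, s (Q.vr a i j) = s' (Q.vr a i j) := by
      intro i j
      have hz : ∀ b i' j', b ≠ a → Q.mB B (Q.vr b i' j') (Sum.inl (Q.vr a i j)) = 0 := by
        intro b i' j' hb
        by_cases hbB : b ∈ B
        · rw [mB_in hbB]; simp [Finsupp.single_apply]
        · rw [mB_out hbB]; simp [Finsupp.single_apply, vr_ne hb]
      have := (weight_mB B s _ a hz).symm.trans ((DFunLike.congr_fun hw _).trans (weight_mB B s' _ a hz))
      fin_cases i <;> fin_cases j <;> simpa [mB_out ha, Finsupp.single_apply, vr_inj] using this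
    simp only [key]

lemma IB_of_rhoB (B : Finset Q.A) {f : MvPolynomial Q.Var K} (hf : Q.rhoB K B f = 0) :
    f ∈ Q.IB K B := by
  refine ker_monomial (Q.rhoB K B).toLinearMap (fun s => Finsupp.weight (Q.mB B) s)
    (fun s => rhoB_monomial B s) ((Q.IB K B).restrictScalars K) f ?_ hf
  intro s _ s' _ hss
  have key := mB_aux B (Ideal.Quotient.mk (Q.IB K B)) ?_ s s' hss
  · exact Ideal.Quotient.eq.1 key
  · intro b hb
    rw [← map_mul, ← map_mul, Ideal.Quotient.eq]
    have : (Q.genMat K b).det ∈ Q.IB K B := Ideal.subset_span ⟨b, hb, rfl⟩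
    rwa [Matrix.det_fin_two] at this

lemma IB_cancel {B : Finset Q.A} {a : Q.A} (ha : a ∉ B) {q : MvPolynomial Q.Var K}
    (h : (Q.genMat K a).det * q ∈ Q.IB K B) : q ∈ Q.IB K B := by
  have h1 := rhoB_IB h
  rw [map_mul] at h1
  refine IB_of_rhoB B ((mul_eq_zero.1 h1).resolve_left fun h2 => ?_)
  rw [Matrix.det_fin_two] at h2
  simp only [genMat_apply, map_sub, map_mul, rhoB_out ha] at h2
  have h3 := congrArg (eval fun x : Q.Var ⊕ (Q.HE × Fin 2) =>
    if x = Sum.inl (Q.vr a 0 0) ∨ x = Sum.inl (Q.vr a 1 1) then (1 : K) else 0) h2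
  simp [vr_inj] at h3

lemma rho_univ (f : MvPolynomial Q.Var K) :
    Q.rhoB K Finset.univ f = rename Sum.inr (Q.rho K f) := by
  refine DFunLike.congr_fun (F := MvPolynomial Q.Var K →ₐ[K] MvPolynomial (Q.Var ⊕ (Q.HE × Fin 2)) K)
    (f := Q.rhoB K Finset.univ) (g := (rename Sum.inr).comp (Q.rho K))
    (MvPolynomial.algHom_ext fun p => ?_) f
  obtain ⟨a, i, j⟩ := p
  change Q.rhoB K Finset.univ (X (Q.vr a i j)) = rename Sum.inr (Q.rho K (X (Q.vr a i j)))
  rw [rhoB_in (Finset.mem_univ a), rho_X]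
  fin_cases i <;> fin_cases j <;> simp [tm, rename_X]

lemma IB_univ_iff (f : MvPolynomial Q.Var K) : f ∈ Q.IB K Finset.univ ↔ Q.rho K f = 0 := by
  constructor
  · intro h
    have := rhoB_IB h
    rw [rho_univ] at this
    exact rename_injective _ Sum.inr_injective (this.trans (map_zero _).symm)
  · intro h
    refine IB_of_rhoB _ ?_
    rw [rho_univ, h, map_zero]

lemma rho_wh {E : Multiset Q.A} {f : MvPolynomial Q.Var K} (hf : IsWeightedHomogeneous Q.wA f E) :
    IsWeightedHomogeneous wZ (Q.rho K f) (E.map (fun a => (a, true)) + E.map (fun a => (a, false))) := by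
  let θ : Multiset Q.A →+ Multiset Q.HE :=
    Multiset.mapAddMonoidHom (fun a => (a, true)) + Multiset.mapAddMonoidHom (fun a => (a, false))
  refine wh_map (w := fun p => θ (Q.wA p)) (Q.rho K) ?_ (wh_theta θ hf)
  rintro ⟨a, i, j⟩
  change IsWeightedHomogeneous wZ (Q.rho K (X (Q.vr a i j))) ({(a, true)} + {(a, false)})
  rw [rho_X]
  fin_cases i <;> fin_cases j <;>
    exact (isWeightedHomogeneous_X K wZ ((a, true), _)).mul (isWeightedHomogeneous_X K wZ ((a, false), _))

lemma phase1_base [CharP K 2] [Infinite K] {E : Multiset Q.A} {f : MvPolynomial Q.Var K}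
    (hf : IsWeightedHomogeneous Q.wA f E)
    (hi : ∀ g : Q.V → Matrix (Fin 2) (Fin 2) K, (∀ v, (g v).det = 1) →
      Q.act K g f - f ∈ Q.IB K Finset.univ) :
    ∃ F ∈ Q.GSp K E, f - F ∈ Q.IB K Finset.univ := by
  have h1 : SLinv K Q.vert (Q.rho K f) := by
    intro g hg
    rw [← rho_act g hg, ← sub_eq_zero, ← map_sub]
    exact (IB_univ_iff _).1 (hi g hg)
  have h2 := fft (vert := Q.vert) _ _ (Q.rho K f) le_rfl (rho_wh hf) h1
  have : BSp K Q.vert (E.map (fun a => (a, true)) + E.map (fun a => (a, false))) ≤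
      (Q.GSp K E).map (Q.rho K).toLinearMap := by
    refine Submodule.span_le.2 ?_
    rintro x ⟨L, hL, hE, rfl⟩
    obtain ⟨Ws, hc, ha, hr⟩ := lift_BP (K := K) E L hL hE
    refine ⟨Q.GP K 0 Ws, Submodule.subset_span ⟨0, Ws, hc, by simp [ha], rfl⟩, ?_⟩
    rw [← hr]
    simp [GP]
  obtain ⟨F, hF, hF'⟩ := this h2
  refine ⟨F, hF, (IB_univ_iff _).2 ?_⟩
  rw [map_sub, ← hF']
  exact sub_self _

theorem phase1 [CharP K 2] [Infinite K] (n : ℕ) : ∀ (E : Multiset Q.A), Multiset.card E = n →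
    ∀ (k : ℕ) (B : Finset Q.A), (Finset.univ \ B).card = k → ∀ f : MvPolynomial Q.Var K,
    IsWeightedHomogeneous Q.wA f E →
    (∀ g : Q.V → Matrix (Fin 2) (Fin 2) K, (∀ v, (g v).det = 1) → Q.act K g f - f ∈ Q.IB K B) →
    ∃ F ∈ Q.GSp K E, f - F ∈ Q.IB K B := by
  induction n using Nat.strong_induction_on with
  | _ n IH =>
  intro E hE k
  induction k with
  | zero =>
    intro B hB f hf hi
    have : B = Finset.univ := by
      rw [Finset.card_eq_zero, Finset.sdiff_eq_empty_iff_subset] at hB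
      exact Finset.univ_subset_iff.1 hB
    subst this
    exact phase1_base hf hi
  | succ k ih =>
    intro B hB f hf hi
    obtain ⟨a, ha⟩ := Finset.card_pos.1 (by omega : 0 < (Finset.univ \ B).card)
    have haB : a ∉ B := (Finset.mem_sdiff.1 ha).2
    obtain ⟨F, hF, hFi⟩ := ih (insert a B) (by
      have : Finset.univ \ insert a B = (Finset.univ \ B).erase a := by
        ext x; simp [not_or]
      rw [this, Finset.card_erase_of_mem ha, hB]
      rfl) f hf (fun g hg => IB_mono (Finset.subset_insert a B) (hi g hg))
    rw [IB, Finset.coe_insert, Set.image_insert_eq, Ideal.mem_span_insert] at hFi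
    obtain ⟨q, i, hiB, hq⟩ := hFi
    change i ∈ Q.IB K B at hiB
    have hw : IsWeightedHomogeneous Q.wA (f - F) E := wh_sub hf (GSp_wh hF)
    have hq' : f - F = weightedHomogeneousComponent Q.wA E ((Q.genMat K a).det * q) +
        weightedHomogeneousComponent Q.wA E i := by
      rw [← map_add, mul_comm, ← hq, whc_self hw]
    have hi2 := IB_whc B E hiB
    set i2 := weightedHomogeneousComponent Q.wA E i with hi2d
    by_cases hEa : ∃ E2, E = {a} + {a} + E2
    · obtain ⟨E2, rfl⟩ := hEa
      rw [whc_mul (det_wh a)] at hq'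
      set q2 := weightedHomogeneousComponent Q.wA E2 q with hq2d
      have hq2w : IsWeightedHomogeneous Q.wA q2 E2 :=
        weightedHomogeneousComponent_isWeightedHomogeneous _ _
      have hq2i : ∀ g : Q.V → Matrix (Fin 2) (Fin 2) K, (∀ v, (g v).det = 1) →
          Q.act K g q2 - q2 ∈ Q.IB K B := by
        intro g hg
        refine IB_cancel haB ?_
        have e : (Q.genMat K a).det * (Q.act K g q2 - q2) = (Q.act K g f - f) - (Q.act K g i2 - i2) := by
          have h1 := congrArg (Q.act K g) hq'
          rw [map_sub, GSp_act hF g hg, map_add, map_mul, det_act g hg] at h1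
          linear_combination hq' - h1
        rw [e]
        exact Ideal.sub_mem _ (hi g hg) (Ideal.sub_mem _ (IB_act B g hg hi2) hi2)
      obtain ⟨F2, hF2, hF2i⟩ := IH (Multiset.card E2) (by
        rw [← hE]; simp only [Multiset.card_add, Multiset.card_singleton]; omega) E2 rfl _ B rfl q2 hq2w hq2i
      refine ⟨F + (Q.genMat K a).det * F2, Submodule.add_mem _ hF ?_, ?_⟩
      · have : Q.GSp K E2 ≤ (Q.GSp K ({a} + {a} + E2)).comap
            (LinearMap.mulLeft K (Q.genMat K a).det) := by
          refine Submodule.span_le.2 ?_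
          rintro x ⟨e, Ws, h1, rfl, rfl⟩
          refine Submodule.subset_span ⟨a ::ₘ e, Ws, h1, ?_, ?_⟩
          · rw [← Multiset.singleton_add]; abel
          · simp [GP, mul_assoc]
        exact this hF2
      · have e : f - (F + (Q.genMat K a).det * F2) = (Q.genMat K a).det * (q2 - F2) + i2 := by
          linear_combination hq'
        rw [e]
        exact Ideal.add_mem _ (Ideal.mul_mem_left _ _ hF2i) hi2
    · push Not at hEa
      rw [whc_mul_zero (det_wh a) _ _ hEa, zero_add] at hq'
      exact ⟨F, hF, hq' ▸ hi2⟩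

theorem phase1_final [CharP K 2] [Infinite K] {E : Multiset Q.A} {f : MvPolynomial Q.Var K}
    (hf : IsWeightedHomogeneous Q.wA f E)
    (hi : ∀ g : Q.V → Matrix (Fin 2) (Fin 2) K, (∀ v, (g v).det = 1) → Q.act K g f = f) :
    f ∈ Q.GSp K E := by
  obtain ⟨F, hF, h⟩ := phase1 _ E rfl _ ∅ rfl f hf (fun g hg => by
    rw [hi g hg, sub_self]; exact Ideal.zero_mem _)
  have h0 : Q.IB K ∅ = ⊥ := by simp [IB]
  rw [h0, Ideal.mem_bot, sub_eq_zero] at h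
  rwa [h]

end Phase1
end QuiverData


namespace QuiverData

section Assembly
open MvPolynomial
variable {Q : QuiverData} {K : Type} [Field K]

lemma act_gen_wh (g : Q.V → Matrix (Fin 2) (Fin 2) K) (p : Q.Var) :
    IsWeightedHomogeneous Q.wA (Q.act K g (X p)) (Q.wA p) := by
  rw [act, aeval_X, actVar]
  refine IsWeightedHomogeneous.sum _ _ _ fun k _ => IsWeightedHomogeneous.sum _ _ _ fun l _ => ?_
  have h := (isWeightedHomogeneous_C Q.wA
    (g (Q.tgt p.1) p.2.1 k * (g (Q.src p.1))⁻¹ l p.2.2)).mul (gen_wh (K := K) p.1 k l)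
  rw [zero_add] at h
  exact h

/-- the torus element equal to `t` at `v` and to `1` elsewhere. -/
noncomputable def scl (v : Q.V) (t : K) (u : Q.V) : Matrix (Fin 2) (Fin 2) K :=
  Matrix.diagonal fun _ => if u = v then t else 1

lemma scl_det (v : Q.V) {t : K} (ht : t ≠ 0) (u : Q.V) : IsUnit (Q.scl v t u).det := by
  rw [scl, Matrix.det_fin_two]
  split_ifs <;> simp [ht]

lemma scl_inv (v : Q.V) {t : K} (ht : t ≠ 0) (u : Q.V) : (Q.scl v t u)⁻¹ = Q.scl v t⁻¹ u := by
  refine Matrix.inv_eq_right_inv ?_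
  rw [scl, scl, Matrix.diagonal_mul_diagonal, ← Matrix.diagonal_one]
  congr 1
  funext i
  split_ifs <;> simp [ht]

noncomputable def chr (v : Q.V) (t : K) (S : Multiset Q.A) : K :=
  t ^ (S.map (Q.bd v)).sum

lemma act_scl (v : Q.V) {t : K} (ht : t ≠ 0) :
    Q.actVar K (Q.scl v t) = fun p => C (chr v t (Q.wA p)) * X p := by
  funext p
  obtain ⟨a, i, j⟩ := p
  have e : chr v t (Q.wA (a, i, j)) = (if Q.tgt a = v then t else 1) * (if Q.src a = v then t⁻¹ else 1) := by
    have : Q.wA (a, i, j) = {a} := rfl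
    rw [chr, this, Multiset.map_singleton, Multiset.sum_singleton, bd]
    split_ifs <;> simp [ht]
  rw [e]
  unfold actVar
  simp only [scl_inv v ht, Fin.sum_univ_two]
  have z1 : ∀ c x y z w : MvPolynomial Q.Var K, c * x + 0 * y + (0 * z + 0 * w) = c * x := by
    intros; ring
  have z2 : ∀ c x y z w : MvPolynomial Q.Var K, 0 * x + c * y + (0 * z + 0 * w) = c * y := by
    intros; ring
  have z3 : ∀ c x y z w : MvPolynomial Q.Var K, 0 * x + 0 * y + (c * z + 0 * w) = c * z := by
    intros; ring
  have z4 : ∀ c x y z w : MvPolynomial Q.Var K, 0 * x + 0 * y + (0 * z + c * w) = c * w := by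
    intros; ring
  fin_cases i <;> fin_cases j <;> simp [scl]
  · exact z1 _ _ _ _ _
  · exact z2 _ _ _ _ _
  · exact z3 _ _ _ _ _
  · exact z4 _ _ _ _ _

lemma bd_zero [Infinite K] [Fintype Q.A] {E : Multiset Q.A} {f : MvPolynomial Q.Var K}
    (hf : IsWeightedHomogeneous Q.wA f E) (hi : Q.IsInvariant K f) (h0 : f ≠ 0) (v : Q.V) :
    (E.map (Q.bd v)).sum = 0 := by
  by_contra hne
  obtain ⟨t, ht, htr⟩ := exists_pow_ne_one (K := K) (E.map (Q.bd v)).sum.natAbs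
    (Int.natAbs_pos.2 hne)
  have h1 := hi (Q.scl v t) (scl_det v ht)
  rw [act_scl v ht, wh_scale (chr v t) (by simp [chr])
    (by intro a b; simp [chr, zpow_add₀ ht]) hf] at h1
  have h2 : C (chr v t E) = (1 : MvPolynomial Q.Var K) := mul_right_cancel₀ h0 (by rw [h1, one_mul])
  have h3 : chr v t E = 1 := C_injective _ _ (by rw [h2, C_1])
  apply htr
  rw [chr] at h3
  rcases Int.natAbs_eq (E.map (Q.bd v)).sum with h | h
  · rw [h] at h3
    exact_mod_cast h3
  · rw [h, zpow_neg, inv_eq_one] at h3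
    exact_mod_cast h3

lemma arr_bd (v : Q.V) (Ws : Multiset (List Q.HE)) :
    ((Ws.map arr).sum.map (Q.bd v)).sum = (Ws.map (Q.wbd v)).sum := by
  induction Ws using Multiset.induction_on with
  | empty => simp
  | cons W Ws ih =>
    simp only [Multiset.map_cons, Multiset.sum_cons, Multiset.map_add, Multiset.sum_add, ih]
    congr 1
    simp [arr, wbd, Function.comp_def]

theorem inv_mem_TT [CharP K 2] [Infinite K] [Fintype Q.A] {f : MvPolynomial Q.Var K}
    (hi : Q.IsInvariant K f) : f ∈ TT Q K := by
  have key : ∀ E, weightedHomogeneousComponent Q.wA E f ∈ TT Q K := by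
    intro E
    have hw : IsWeightedHomogeneous Q.wA (weightedHomogeneousComponent Q.wA E f) E :=
      weightedHomogeneousComponent_isWeightedHomogeneous _ _
    have hinv : Q.IsInvariant K (weightedHomogeneousComponent Q.wA E f) := by
      intro g hg
      have h := whc_map (Q.act K g) (act_gen_wh g) f E
      have h2 : Q.act K g f = f := hi g hg
      rw [h2] at h
      exact h.symm
    by_cases h0 : weightedHomogeneousComponent Q.wA E f = 0
    · rw [h0]; exact Subalgebra.zero_mem _
    have h1 : weightedHomogeneousComponent Q.wA E f ∈ Q.GSp K E :=
      phase1_final hw fun g hg => hinv g fun v => by rw [hg]; exact isUnit_one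
    have h2 : Q.GSp K E ≤ Subalgebra.toSubmodule (TT Q K) := by
      refine Submodule.span_le.2 ?_
      rintro x ⟨e, Ws, hc, hE, rfl⟩
      refine phase2 K _ e Ws le_rfl hc fun v => ?_
      have hb := bd_zero hw hinv h0 v
      rw [← hE, Multiset.map_add, Multiset.map_add, Multiset.sum_add, Multiset.sum_add, arr_bd] at hb
      rw [two_mul]
      exact hb
    exact h2 h1
  rw [← sum_weightedHomogeneousComponent Q.wA f]
  exact finsum_induction (fun x => x ∈ TT Q K) (Subalgebra.zero_mem _)
    (fun _ _ => Subalgebra.add_mem _) key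

end Assembly
end QuiverData

/-- **Theorem (upper bound, char 2).** Let `K` be an infinite field with `char K = 2`
and `Q` a strongly connected quiver with `n` vertices, `d ≥ 2` arrows and `m(Q) = m`.
Then `D(Q,(2,…,2)) ≤ m·d`: every indecomposable homogeneous invariant of
`Inv(Q,(2,…,2))` has degree at most `m·d`. -/
theorem degree_bound_char_two
    (K : Type) [Field K] [Infinite K] (hchar : ringChar K = 2)
    (Q : QuiverData) [Fintype Q.V] [Fintype Q.A] (n d m : ℕ)
    (hn : Fintype.card Q.V = n) (hd : Fintype.card Q.A = d) (hd2 : 2 ≤ d)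
    (hsc : Q.StronglyConnected) (hm : Q.MaxPrimDeg m)
    (f : MvPolynomial Q.Var K) (k : ℕ)
    (hf : Q.IsInvariant K f) (hhom : f.IsHomogeneous k)
    (hind : ¬ Q.Decomposable K f) :
    k ≤ m * d := by
  have hC : CharP K 2 := ringChar.of_eq hchar
  by_contra hlt
  push Not at hlt
  subst hd
  exact hind (QuiverData.phase3 K hm hd2 (QuiverData.inv_mem_TT hf) hhom hlt)
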